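/- Let ω be a radial weight in the class D̂ and let 1<p,q<∞. Then the maximal Bergman projection P_ω^+ is bounded on L^{p,q}_ω (i.e., there exists C>0 such that ‖P_ω^+ f‖_{L^{p,q}_ω} ≤ C‖f‖_{L^{p,q}_ω} for all f∈L^{p,q}_ω) if and only if ω belongs to the class Ď (equivalently, ω∈D=D̂∩Ď). -/

import Mathlib

open MeasureTheory Filter Set
open scoped ENNReal

noncomputable section

/-- `ω̂(r) = ∫_r^1 ω(s) ds`. -/
def omegaHat (ω : ℝ → ℝ) (r : ℝ) : ℝ := ∫ s in r..1, ω s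

/-- A radial weight: nonnegative and Lebesgue integrable on `[0,1)`. -/
def IsRadialWeight (ω : ℝ → ℝ) : Prop :=
  (∀ r ∈ Set.Ico (0:ℝ) 1, 0 ≤ ω r) ∧ MeasureTheory.IntegrableOn ω (Set.Ico 0 1)

/-- The class `D̂` of upper doubling radial weights. -/
def InDhat (ω : ℝ → ℝ) : Prop :=
  ∃ C > (0:ℝ), ∀ r ∈ Set.Ico (0:ℝ) 1, omegaHat ω r ≤ C * omegaHat ω ((1 + r) / 2)

/-- The class `Ď`. -/
def InDcheck (ω : ℝ → ℝ) : Prop :=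
  ∃ K > (1:ℝ), ∃ C > (1:ℝ), ∀ r ∈ Set.Ico (0:ℝ) 1,
    C * omegaHat ω (1 - (1 - r) / K) ≤ omegaHat ω r

/-- Moments `μ_x = ∫_0^1 r^x μ(r) dr`. -/
def momentW (μ : ℝ → ℝ) (x : ℝ) : ℝ := ∫ r in (0:ℝ)..1, r ^ x * μ r

/-- The coefficients `μ_{2k+1}` of the `A²_μ` pairing. -/
def momentCoeff (μ : ℝ → ℝ) : ℕ → ℝ := fun k => momentW μ (2 * (k:ℝ) + 1)

/-- The point `r e^{iθ}` of the circle of radius `r`. -/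
def circlePt (r θ : ℝ) : ℂ := (r:ℂ) * Complex.exp ((θ:ℂ) * Complex.I)

/-- Integral means `M_p(r,f)` (with values in `[0,∞]`). -/
def MpE (p r : ℝ) (f : ℂ → ℂ) : ℝ≥0∞ :=
  (ENNReal.ofReal (1 / (2 * Real.pi)) *
    ∫⁻ θ in Set.Ioo (0:ℝ) (2 * Real.pi), ENNReal.ofReal (‖f (circlePt r θ)‖ ^ p)) ^ (1 / p)

/-- Integral means of a `[0,∞]`-valued function. -/
def MpEE (p r : ℝ) (F : ℂ → ℝ≥0∞) : ℝ≥0∞ :=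
  (ENNReal.ofReal (1 / (2 * Real.pi)) *
    ∫⁻ θ in Set.Ioo (0:ℝ) (2 * Real.pi), (F (circlePt r θ)) ^ p) ^ (1 / p)

/-- The norm of the mixed norm space `L^{p,q}_ω`. -/
def LpqNormE (ω : ℝ → ℝ) (p q : ℝ) (f : ℂ → ℂ) : ℝ≥0∞ :=
  (∫⁻ r in Set.Ioo (0:ℝ) 1, (MpE p r f) ^ q * ENNReal.ofReal (r * ω r)) ^ (1 / q)

/-- The `L^{p,q}_ω` norm of a `[0,∞]`-valued function. -/
def LpqNormEE (ω : ℝ → ℝ) (p q : ℝ) (F : ℂ → ℝ≥0∞) : ℝ≥0∞ :=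
  (∫⁻ r in Set.Ioo (0:ℝ) 1, (MpEE p r F) ^ q * ENNReal.ofReal (r * ω r)) ^ (1 / q)

/-- The norm of `A^{p,∞}_ω` : `sup_{0 ≤ r < 1} M_p(r,f) ω̂(r)`. -/
def ApInfNormE (ω : ℝ → ℝ) (p : ℝ) (f : ℂ → ℂ) : ℝ≥0∞ :=
  ⨆ r ∈ Set.Ico (0:ℝ) 1, MpE p r f * ENNReal.ofReal (omegaHat ω r)

/-- Membership in the mixed norm space `A^{p,q}_ω`. -/
def InApq (ω : ℝ → ℝ) (p q : ℝ) (f : ℂ → ℂ) : Prop :=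
  DifferentiableOn ℂ f (Metric.ball 0 1) ∧ LpqNormE ω p q f < ⊤

/-- Membership in `A^{p,∞}_ω`. -/
def InApInf (ω : ℝ → ℝ) (p : ℝ) (f : ℂ → ℂ) : Prop :=
  DifferentiableOn ℂ f (Metric.ball 0 1) ∧ ApInfNormE ω p f < ⊤

/-- Taylor coefficient of `f` at `0`. -/
def taylorCoeff (f : ℂ → ℂ) (n : ℕ) : ℂ := iteratedDeriv n f 0 / (n.factorial : ℂ)

/-- The pairing `⟨f,g⟩ = lim_{r→1⁻} ∑_k f̂(k) conj(ĝ(k)) c(k) r^k` exists and equals `l`. -/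
def HasPairingC (c : ℕ → ℝ) (f g : ℂ → ℂ) (l : ℂ) : Prop :=
  (∀ r ∈ Set.Ico (0:ℝ) 1, Summable (fun k : ℕ =>
    taylorCoeff f k * (starRingEnd ℂ) (taylorCoeff g k) * ((c k : ℝ) : ℂ) * ((r:ℂ)) ^ k)) ∧
  Filter.Tendsto (fun r : ℝ => ∑' k : ℕ,
    taylorCoeff f k * (starRingEnd ℂ) (taylorCoeff g k) * ((c k : ℝ) : ℂ) * ((r:ℂ)) ^ k)
    (nhdsWithin 1 (Set.Iio 1)) (nhds l)

/-- `L` is linear on the functions satisfying `P`. -/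
def IsLinearOn (P : (ℂ → ℂ) → Prop) (L : (ℂ → ℂ) → ℂ) : Prop :=
  (∀ f g : ℂ → ℂ, P f → P g → L (f + g) = L f + L g) ∧
  (∀ (c : ℂ) (f : ℂ → ℂ), P f → L (c • f) = c * L f)

/-- Dilation `f_r(z) = f(rz)`. -/
def dilateF (f : ℂ → ℂ) (r : ℝ) : ℂ → ℂ := fun z => f ((r:ℂ) * z)

/-- The BMOA norm `|f(0)| + sup_{a∈D} sup_{0<r<1} M₂(r, f∘φ_a - f(a))`. -/
def BMOANormE (f : ℂ → ℂ) : ℝ≥0∞ :=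
  ENNReal.ofReal ‖f 0‖ +
    ⨆ a ∈ Metric.ball (0:ℂ) 1, ⨆ r ∈ Set.Ioo (0:ℝ) 1,
      MpE 2 r (fun z => f ((a - z) / (1 - (starRingEnd ℂ) a * z)) - f a)

/-- The Bloch norm `|f(0)| + sup_{z∈D} (1-|z|²)|f'(z)|`. -/
def BlochNormE (f : ℂ → ℂ) : ℝ≥0∞ :=
  ENNReal.ofReal ‖f 0‖ +
    ⨆ z ∈ Metric.ball (0:ℂ) 1, ENNReal.ofReal ((1 - ‖z‖ ^ 2) * ‖deriv f z‖)

/-- The norm of `X(q,ω)`: `(∫_0^1 ‖f_r‖_X^q ω(r) dr)^{1/q}`. -/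
def XqNormE (Xnorm : (ℂ → ℂ) → ℝ≥0∞) (ω : ℝ → ℝ) (q : ℝ) (f : ℂ → ℂ) : ℝ≥0∞ :=
  (∫⁻ r in Set.Ioo (0:ℝ) 1, (Xnorm (dilateF f r)) ^ q * ENNReal.ofReal (ω r)) ^ (1 / q)

/-- The norm of `X(∞,ω)`: `sup_{0<r<1} ‖f_r‖_X ω̂(r)`. -/
def XInfNormE (Xnorm : (ℂ → ℂ) → ℝ≥0∞) (ω : ℝ → ℝ) (f : ℂ → ℂ) : ℝ≥0∞ :=
  ⨆ r ∈ Set.Ioo (0:ℝ) 1, Xnorm (dilateF f r) * ENNReal.ofReal (omegaHat ω r)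

/-- The standard radial weight `ν_β(r) = (β+1)(1-r²)^β`. -/
def nuWeight (β : ℝ) : ℝ → ℝ := fun r => (β + 1) * (1 - r ^ 2) ^ β

/-- The Bergman reproducing kernel `B^ω_a(z) = ∑ (z conj a)^n / (2 ω_{2n+1})`. -/
def bergmanKernel (ω : ℝ → ℝ) (a z : ℂ) : ℂ :=
  ∑' n : ℕ, (z * (starRingEnd ℂ) a) ^ n / (2 * ((momentW ω (2 * (n:ℝ) + 1) : ℝ) : ℂ))

/-- The Bergman projection (`dA` is normalized area measure). -/
def PomegaProj (ω : ℝ → ℝ) (f : ℂ → ℂ) (z : ℂ) : ℂ :=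
  (Real.pi)⁻¹ • ∫ ζ in Metric.ball (0:ℂ) 1,
    f ζ * (starRingEnd ℂ) (bergmanKernel ω z ζ) * ((ω ‖ζ‖ : ℝ) : ℂ)

/-- The maximal Bergman projection applied to `|f|`, with values in `[0,∞]`. -/
def PomegaPlusL (ω : ℝ → ℝ) (f : ℂ → ℂ) (z : ℂ) : ℝ≥0∞ :=
  ∫⁻ ζ in Metric.ball (0:ℂ) 1,
    ENNReal.ofReal (‖f ζ‖ * ‖bergmanKernel ω z ζ‖ * ω ‖ζ‖ / Real.pi)

/-- The Hardy `H¹` norm. -/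
def H1NormE (f : ℂ → ℂ) : ℝ≥0∞ := ⨆ r ∈ Set.Ioo (0:ℝ) 1, MpE 1 r f

/-- `r_n = inf{ r ∈ [0,1) : ω̂(r) = ω̂(0) K^{-n} }`. -/
def rSeq (ω : ℝ → ℝ) (K : ℝ) (n : ℕ) : ℝ :=
  sInf {r | r ∈ Set.Ico (0:ℝ) 1 ∧ omegaHat ω r = omegaHat ω 0 * K ^ (-(n:ℝ))}

/-- `M_n = ⌊1/(1-r_n)⌋`. -/
def MSeq (ω : ℝ → ℝ) (K : ℝ) (n : ℕ) : ℕ := ⌊1 / (1 - rSeq ω K n)⌋₊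

/-- Weighted Hadamard product of a polynomial with an analytic function:
`z ↦ ∑_j c(j) P̂(j) ĝ(j) z^j`. -/
def hadamardPolyC (c : ℕ → ℂ) (P : Polynomial ℂ) (g : ℂ → ℂ) : ℂ → ℂ :=
  fun z => ∑ j ∈ Finset.range (P.natDegree + 1), c j * P.coeff j * taylorCoeff g j * z ^ j

/-- An admissible Banach space of analytic functions on the unit disc, given by a
carrier set and a norm function. -/
structure AdmissibleSpace where
  carrier : Set (ℂ → ℂ)
  nrm : (ℂ → ℂ) → ℝ
  mem_analytic : ∀ f ∈ carrier, DifferentiableOn ℂ f (Metric.ball 0 1)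
  zero_mem : (0 : ℂ → ℂ) ∈ carrier
  add_mem : ∀ f g : ℂ → ℂ, f ∈ carrier → g ∈ carrier → f + g ∈ carrier
  smul_mem : ∀ (c : ℂ) (f : ℂ → ℂ), f ∈ carrier → c • f ∈ carrier
  nrm_nonneg : ∀ f ∈ carrier, 0 ≤ nrm f
  nrm_eq_zero : ∀ f ∈ carrier, nrm f = 0 → ∀ z ∈ Metric.ball (0:ℂ) 1, f z = 0
  nrm_add : ∀ f g : ℂ → ℂ, f ∈ carrier → g ∈ carrier → nrm (f + g) ≤ nrm f + nrm g
  nrm_smul : ∀ (c : ℂ) (f : ℂ → ℂ), f ∈ carrier → nrm (c • f) = ‖c‖ * nrm f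
  complete : ∀ u : ℕ → (ℂ → ℂ), (∀ n, u n ∈ carrier) →
    (∀ ε : ℝ, 0 < ε → ∃ N : ℕ, ∀ m ≥ N, ∀ n ≥ N, nrm (u m - u n) < ε) →
    ∃ f ∈ carrier, Filter.Tendsto (fun n => nrm (u n - f)) Filter.atTop (nhds 0)
  norm_conv_implies_ucc : ∀ (u : ℕ → (ℂ → ℂ)) (f : ℂ → ℂ),
    (∀ n, u n ∈ carrier) → f ∈ carrier →
    Filter.Tendsto (fun n => nrm (u n - f)) Filter.atTop (nhds 0) →
    ∀ Kc : Set ℂ, Kc ⊆ Metric.ball 0 1 → IsCompact Kc →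
      TendstoUniformlyOn (fun n => u n) f Filter.atTop Kc
  ucc_implies_norm_conv : ∀ R : ℝ, 1 < R → ∀ (u : ℕ → (ℂ → ℂ)) (f : ℂ → ℂ),
    (∀ n, u n ∈ carrier ∧ DifferentiableOn ℂ (u n) (Metric.ball 0 R)) →
    DifferentiableOn ℂ f (Metric.ball 0 R) →
    (∀ Kc : Set ℂ, Kc ⊆ Metric.ball (0:ℂ) R → IsCompact Kc →
      TendstoUniformlyOn (fun n => u n) f Filter.atTop Kc) →
    f ∈ carrier ∧ Filter.Tendsto (fun n => nrm (u n - f)) Filter.atTop (nhds 0)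
  dilation_bound : ∃ C > (0:ℝ), ∀ f ∈ carrier, ∀ ζ : ℂ, ‖ζ‖ ≤ 1 →
    (fun z => f (ζ * z)) ∈ carrier ∧ nrm (fun z => f (ζ * z)) ≤ C * nrm f

/-- The operator `T_p = I^{ν_{1/p-2}}`. -/
def TpOp (p : ℝ) (g : ℂ → ℂ) : ℂ → ℂ :=
  fun z => ∑' k : ℕ,
    taylorCoeff g k * ((momentW (nuWeight (1 / p - 2)) (2 * (k:ℝ) + 1) : ℝ) : ℂ) * z ^ k

/-- Membership in the Bloch space. -/
def InBloch (g : ℂ → ℂ) : Prop :=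
  DifferentiableOn ℂ g (Metric.ball 0 1) ∧ BlochNormE g < ⊤

open Classical in
/-- The norm of the space `X_p = T_p(B)`, normed so that `T_p` is an isometry. -/
def XpNormE (p : ℝ) (h : ℂ → ℂ) : ℝ≥0∞ :=
  if H : ∃ g : ℂ → ℂ, InBloch g ∧ Set.EqOn h (TpOp p g) (Metric.ball 0 1)
  then BlochNormE H.choose else ⊤

/-- The polynomial `V_n ∗ g` where `V_n(z) = ∑_{j=2^{n-1}}^{2^{n+1}-1} ψ(j/2^{n-1}) z^j`
and `ψ(t) = Ψ(t/2) - Ψ(t)`. -/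
def VnStar (Ψ : ℝ → ℝ) (n : ℕ) (g : ℂ → ℂ) : ℂ → ℂ :=
  fun z => ∑ j ∈ Finset.Icc (2 ^ (n - 1) : ℕ) (2 ^ (n + 1) - 1 : ℕ),
    (((Ψ ((j:ℝ) / 2 ^ n) - Ψ ((j:ℝ) / 2 ^ (n - 1))) : ℝ) : ℂ) * taylorCoeff g j * z ^ j

/-- `D^ω(V_n ∗ g)`, where `D^ω h(z) = ∑ ĥ(k) z^k/(2ω_{2k+1})`. -/
def DVnStar (Ψ : ℝ → ℝ) (ω : ℝ → ℝ) (n : ℕ) (g : ℂ → ℂ) : ℂ → ℂ :=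
  fun z => ∑ j ∈ Finset.Icc (2 ^ (n - 1) : ℕ) (2 ^ (n + 1) - 1 : ℕ),
    (((Ψ ((j:ℝ) / 2 ^ n) - Ψ ((j:ℝ) / 2 ^ (n - 1))) : ℝ) : ℂ) * taylorCoeff g j * z ^ j /
      (2 * ((momentW ω (2 * (j:ℝ) + 1) : ℝ) : ℂ))

/-- `J_ω(t) = ∫_0^t ds/(ω̂(s)(1-s))`. -/
def Jomega (ω : ℝ → ℝ) (t : ℝ) : ℝ := ∫ s in (0:ℝ)..t, 1 / (omegaHat ω s * (1 - s))

/-- A measurable, nonnegative, integrable radial weight that vanishes off `(0,1)`. -/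
structure NiceWeight (ω : ℝ → ℝ) : Prop where
  meas : Measurable ω
  nonneg : ∀ s, 0 ≤ ω s
  supp : ∀ s, s ∉ Set.Ioo (0:ℝ) 1 → ω s = 0
  int : Integrable ω

/-- The measure `ω(s) ds` on the line. -/
def weightMeasure (ω : ℝ → ℝ) : Measure ℝ := volume.withDensity (fun s => ENNReal.ofReal (ω s))

/-- Moments `∫ s^j ω(s) ds` with natural exponents. -/
def natMoment (ω : ℝ → ℝ) (j : ℕ) : ℝ := ∫ s, s ^ j * ω s

namespace NiceWeight

variable {ω : ℝ → ℝ}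

lemma omegaHat_eq (h : NiceWeight ω) (r : ℝ) : omegaHat ω r = ∫ s in Ioi r, ω s := by
  unfold omegaHat
  have h1 : ∫ s in Ioi (1:ℝ), ω s = 0 :=
    setIntegral_eq_zero_of_forall_eq_zero fun s hs => h.supp s fun h' => absurd h'.2 (not_lt.2 hs.le)
  have := intervalIntegral.integral_Ioi_sub_Ioi' (μ := volume) (f := ω) (a := r) (b := 1)
    h.int.integrableOn h.int.integrableOn
  rw [h1, sub_zero] at this
  exact this.symm

lemma omegaHat_antitone (h : NiceWeight ω) : Antitone (omegaHat ω) := by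
  intro a b hab
  rw [h.omegaHat_eq, h.omegaHat_eq]
  exact setIntegral_mono_set h.int.integrableOn (ae_of_all _ h.nonneg)
    (Ioi_subset_Ioi hab).eventuallyLE

lemma omegaHat_continuous (h : NiceWeight ω) : Continuous (omegaHat ω) := by
  have : omegaHat ω = fun r => - ∫ s in (1:ℝ)..r, ω s := by
    funext r; rw [omegaHat, intervalIntegral.integral_symm]
  rw [this]
  exact (intervalIntegral.continuous_primitive (fun a b => h.int.intervalIntegrable) 1).neg

lemma omegaHat_nonneg (h : NiceWeight ω) (r : ℝ) : 0 ≤ omegaHat ω r := by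
  rw [h.omegaHat_eq]; exact integral_nonneg h.nonneg

lemma omegaHat_one (ω : ℝ → ℝ) : omegaHat ω 1 = 0 := by simp [omegaHat]

lemma weightMeasure_Ioi (h : NiceWeight ω) (r : ℝ) :
    weightMeasure ω (Ioi r) = ENNReal.ofReal (omegaHat ω r) := by
  rw [weightMeasure, withDensity_apply _ measurableSet_Ioi, h.omegaHat_eq,
    ofReal_integral_eq_lintegral_ofReal h.int.integrableOn (ae_of_all _ h.nonneg)]

lemma weightMeasure_compl (h : NiceWeight ω) : weightMeasure ω (Ioo (0:ℝ) 1)ᶜ = 0 := by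
  rw [weightMeasure, withDensity_apply _ measurableSet_Ioo.compl]
  refine setLIntegral_eq_zero measurableSet_Ioo.compl fun s hs => ?_
  simp [h.supp s hs]

lemma weightMeasure_ae (h : NiceWeight ω) : ∀ᵐ s ∂(weightMeasure ω), s ∈ Ioo (0:ℝ) 1 :=
  h.weightMeasure_compl

lemma weightMeasure_univ (h : NiceWeight ω) :
    weightMeasure ω univ = ENNReal.ofReal (omegaHat ω 0) := by
  rw [← h.weightMeasure_Ioi]
  refine le_antisymm ?_ (measure_mono (subset_univ _))
  have : (univ : Set ℝ) ⊆ Ioi 0 ∪ (Ioo (0:ℝ) 1)ᶜ := by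
    intro x _
    by_cases hx : x ∈ Ioo (0:ℝ) 1
    · exact Or.inl hx.1
    · exact Or.inr hx
  calc _ ≤ _ := measure_mono this
    _ ≤ _ := measure_union_le _ _
    _ = _ := by rw [h.weightMeasure_compl, add_zero]

lemma weightMeasure_finite (h : NiceWeight ω) : IsFiniteMeasure (weightMeasure ω) :=
  ⟨by rw [h.weightMeasure_univ]; exact ENNReal.ofReal_lt_top⟩

lemma weightMeasure_noAtoms (ω : ℝ → ℝ) (x : ℝ) : weightMeasure ω {x} = 0 := by
  rw [weightMeasure, withDensity_apply _ (measurableSet_singleton x)]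
  simp

lemma weightMeasure_Ici (h : NiceWeight ω) (r : ℝ) :
    weightMeasure ω (Ici r) = ENNReal.ofReal (omegaHat ω r) := by
  rw [← h.weightMeasure_Ioi]
  refine le_antisymm ?_ (measure_mono Ioi_subset_Ici_self)
  rw [← Ioi_insert, insert_eq]
  exact (measure_union_le _ _).trans (by rw [weightMeasure_noAtoms, zero_add])

lemma lintegral_weightMeasure (h : NiceWeight ω) (g : ℝ → ℝ≥0∞) :
    ∫⁻ s, g s ∂(weightMeasure ω) = ∫⁻ s in Ioo (0:ℝ) 1, ENNReal.ofReal (ω s) * g s := by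
  rw [weightMeasure, lintegral_withDensity_eq_lintegral_mul_non_measurable _ h.meas.ennreal_ofReal
    (ae_of_all _ fun _ => ENNReal.ofReal_lt_top), ← lintegral_indicator measurableSet_Ioo]
  congr 1; funext s
  by_cases hs : s ∈ Ioo (0:ℝ) 1
  · simp [hs]
  · simp [hs, h.supp s hs]

lemma integrable_pow_mul (h : NiceWeight ω) (j : ℕ) : Integrable fun s => s ^ j * ω s := by
  refine h.int.mono (((measurable_id.pow_const j).mul h.meas).aestronglyMeasurable)
    (ae_of_all _ fun s => ?_)
  by_cases hs : s ∈ Ioo (0:ℝ) 1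
  · rw [norm_mul]
    refine mul_le_of_le_one_left (norm_nonneg _) ?_
    rw [norm_pow, Real.norm_of_nonneg hs.1.le]
    exact pow_le_one₀ hs.1.le hs.2.le
  · simp [h.supp s hs]

lemma pow_mul_nonneg (h : NiceWeight ω) (j : ℕ) (s : ℝ) : 0 ≤ s ^ j * ω s := by
  by_cases hs : s ∈ Ioo (0:ℝ) 1
  · exact mul_nonneg (pow_nonneg hs.1.le _) (h.nonneg s)
  · simp [h.supp s hs]

lemma natMoment_mono_of_le (h : NiceWeight ω) {f g : ℝ → ℝ} (hf : Integrable fun s => f s * ω s)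
    (hg : Integrable fun s => g s * ω s) (hfg : ∀ s ∈ Ioo (0:ℝ) 1, f s ≤ g s) :
    ∫ s, f s * ω s ≤ ∫ s, g s * ω s := by
  refine integral_mono hf hg fun s => ?_
  by_cases hs : s ∈ Ioo (0:ℝ) 1
  · exact mul_le_mul_of_nonneg_right (hfg s hs) (h.nonneg s)
  · simp [h.supp s hs]

lemma natMoment_antitone (h : NiceWeight ω) : Antitone (natMoment ω) := by
  intro i j hij
  exact h.natMoment_mono_of_le (h.integrable_pow_mul j) (h.integrable_pow_mul i)
    fun s hs => pow_le_pow_of_le_one hs.1.le hs.2.le hij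

lemma ofReal_natMoment (h : NiceWeight ω) (j : ℕ) :
    ENNReal.ofReal (natMoment ω j) = ∫⁻ s, ENNReal.ofReal (s ^ j) ∂(weightMeasure ω) := by
  rw [natMoment, ofReal_integral_eq_lintegral_ofReal (h.integrable_pow_mul j)
    (ae_of_all _ (h.pow_mul_nonneg j)), weightMeasure,
    lintegral_withDensity_eq_lintegral_mul_non_measurable _ h.meas.ennreal_ofReal
    (ae_of_all _ fun _ => ENNReal.ofReal_lt_top)]
  refine lintegral_congr fun s => ?_
  rw [Pi.mul_apply, mul_comm, ENNReal.ofReal_mul (h.nonneg s)]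

lemma pow_mul_omegaHat_le (h : NiceWeight ω) (j : ℕ) {r : ℝ} (hr : 0 ≤ r) :
    r ^ j * omegaHat ω r ≤ natMoment ω j := by
  rw [h.omegaHat_eq, ← integral_const_mul, natMoment]
  calc _ ≤ ∫ s in Ioi r, s ^ j * ω s := by
        refine setIntegral_mono_on (h.int.integrableOn.const_mul _)
          (h.integrable_pow_mul j).integrableOn measurableSet_Ioi fun s hs => ?_
        exact mul_le_mul_of_nonneg_right (pow_le_pow_left₀ hr (le_of_lt hs) _) (h.nonneg s)
    _ ≤ _ := setIntegral_le_integral (h.integrable_pow_mul j) (ae_of_all _ (h.pow_mul_nonneg j))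

lemma natMoment_pos (h : NiceWeight ω) (hpos : ∀ r ∈ Ico (0:ℝ) 1, 0 < omegaHat ω r) (j : ℕ) :
    0 < natMoment ω j :=
  lt_of_lt_of_le (mul_pos (by positivity) (hpos (1/2) (by norm_num)))
    (h.pow_mul_omegaHat_le j (by norm_num : (0:ℝ) ≤ 1/2))

lemma momentW_eq (h : NiceWeight ω) (n : ℕ) :
    momentW ω (2 * (n:ℝ) + 1) = natMoment ω (2 * n + 1) := by
  unfold momentW natMoment
  have e : ∀ s : ℝ, s ^ (2 * (n:ℝ) + 1) = s ^ (2 * n + 1) := fun s => by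
    rw [← Real.rpow_natCast]; push_cast; rfl
  simp_rw [e]
  rw [intervalIntegral.integral_of_le zero_le_one]
  refine setIntegral_eq_integral_of_forall_compl_eq_zero fun s hs => ?_
  rw [h.supp s fun h' => hs ⟨h'.1, h'.2.le⟩, mul_zero]

/-- Moments of a weight in `D̂` are doubling. -/
lemma natMoment_doubling (h : NiceWeight ω) {C : ℝ} (hC : 0 < C)
    (hD : ∀ r ∈ Ico (0:ℝ) 1, omegaHat ω r ≤ C * omegaHat ω ((1 + r) / 2)) (j : ℕ) :
    natMoment ω j ≤ C * natMoment ω (2 * j) := by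
  have hnn : 0 ≤ natMoment ω (2 * j) := integral_nonneg (h.pow_mul_nonneg _)
  rw [← ENNReal.ofReal_le_ofReal_iff (mul_nonneg hC.le hnn), ENNReal.ofReal_mul hC.le,
    h.ofReal_natMoment, h.ofReal_natMoment]
  have nn : ∀ i : ℕ, 0 ≤ᵐ[weightMeasure ω] fun s : ℝ => s ^ i := fun i => by
    filter_upwards [h.weightMeasure_ae] with s hs using pow_nonneg hs.1.le i
  rw [lintegral_eq_lintegral_meas_lt _ (nn j) (by fun_prop),
    lintegral_eq_lintegral_meas_lt _ (nn (2 * j)) (by fun_prop),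
    ← lintegral_const_mul' _ _ ENNReal.ofReal_ne_top]
  refine lintegral_mono fun t => ?_
  set E : Set ℝ := {s | t < s ^ j} ∩ Ioo 0 1 with hE
  have h1 : weightMeasure ω {s | t < s ^ j} = weightMeasure ω E :=
    (measure_inter_conull h.weightMeasure_compl).symm
  rw [h1]
  rcases E.eq_empty_or_nonempty with he | hne
  · simp [he]
  have hbdd : BddBelow E := ⟨0, fun s hs => hs.2.1.le⟩
  set r := sInf E with hr
  have hr0 : 0 ≤ r := le_csInf hne fun s hs => hs.2.1.le
  have hr1 : r < 1 := by
    obtain ⟨s, hs⟩ := hne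
    exact (csInf_le hbdd hs).trans_lt hs.2.2
  calc weightMeasure ω E ≤ weightMeasure ω (Ici r) := measure_mono fun s hs => csInf_le hbdd hs
    _ = ENNReal.ofReal (omegaHat ω r) := h.weightMeasure_Ici r
    _ ≤ ENNReal.ofReal (C * omegaHat ω ((1 + r) / 2)) := ENNReal.ofReal_le_ofReal (hD r ⟨hr0, hr1⟩)
    _ = ENNReal.ofReal C * weightMeasure ω (Ioi ((1 + r) / 2)) := by
        rw [ENNReal.ofReal_mul hC.le, h.weightMeasure_Ioi]
    _ ≤ _ := by
        gcongr
        intro s hs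
        have hs' : (1 + r) / 2 < s := hs
        have hlt : r < s ^ 2 := by nlinarith [sq_nonneg (1 - r)]
        obtain ⟨e, he, hes⟩ := exists_lt_of_csInf_lt hne hlt
        show t < s ^ (2 * j)
        rw [pow_mul]
        exact he.1.trans_le (pow_le_pow_left₀ he.2.1.le hes.le _)

/-- Upper bound for the moments of a weight in `D̂` by its tail. -/
lemma natMoment_le_omegaHat (h : NiceWeight ω) {C : ℝ} (hC : 0 < C)
    (hD : ∀ r ∈ Ico (0:ℝ) 1, omegaHat ω r ≤ C * omegaHat ω ((1 + r) / 2)) (n : ℕ) {r : ℝ}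
    (hr : 0 ≤ r) (hn : C * r ^ n ≤ 1 / 2) : natMoment ω (2 * n + 1) ≤ 2 * omegaHat ω r := by
  refine (h.natMoment_antitone (Nat.le_succ (2 * n))).trans ?_
  have key : natMoment ω (2 * n) ≤ r ^ n * natMoment ω n + omegaHat ω r := by
    have hsplit : natMoment ω (2 * n) =
        (∫ s in Iic r, s ^ (2 * n) * ω s) + ∫ s in Ioi r, s ^ (2 * n) * ω s :=
      (intervalIntegral.integral_Iic_add_Ioi (h.integrable_pow_mul _).integrableOn
        (h.integrable_pow_mul _).integrableOn).symm
    rw [hsplit, h.omegaHat_eq]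
    refine add_le_add ?_ ?_
    · calc _ ≤ ∫ s in Iic r, r ^ n * (s ^ n * ω s) := by
            refine setIntegral_mono_on (h.integrable_pow_mul _).integrableOn
              ((h.integrable_pow_mul n).integrableOn.const_mul _) measurableSet_Iic fun s hs => ?_
            rw [two_mul, pow_add, mul_assoc]
            by_cases hs' : s ∈ Ioo (0:ℝ) 1
            · exact mul_le_mul_of_nonneg_right (pow_le_pow_left₀ hs'.1.le hs n)
                (h.pow_mul_nonneg n s)
            · simp [h.supp s hs']
        _ = r ^ n * ∫ s in Iic r, s ^ n * ω s := integral_const_mul _ _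
        _ ≤ _ := mul_le_mul_of_nonneg_left (setIntegral_le_integral (h.integrable_pow_mul n)
            (ae_of_all _ (h.pow_mul_nonneg n))) (pow_nonneg hr n)
    · refine setIntegral_mono_on (h.integrable_pow_mul _).integrableOn h.int.integrableOn
        measurableSet_Ioi fun s _ => ?_
      by_cases hs' : s ∈ Ioo (0:ℝ) 1
      · exact mul_le_of_le_one_left (h.nonneg s) (pow_le_one₀ hs'.1.le hs'.2.le)
      · simp [h.supp s hs']
  have hd := h.natMoment_doubling hC hD n
  have h0 : 0 ≤ natMoment ω (2 * n) := integral_nonneg (h.pow_mul_nonneg _)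
  have : r ^ n * natMoment ω n ≤ 1 / 2 * natMoment ω (2 * n) := by
    calc _ ≤ r ^ n * (C * natMoment ω (2 * n)) := mul_le_mul_of_nonneg_left hd (pow_nonneg hr n)
      _ = C * r ^ n * natMoment ω (2 * n) := by ring
      _ ≤ _ := mul_le_mul_of_nonneg_right hn h0
  linarith

/-- Difference estimate for the odd moments. -/
lemma natMoment_diff (h : NiceWeight ω) {C : ℝ} (hC : 0 < C)
    (hD : ∀ r ∈ Ico (0:ℝ) 1, omegaHat ω r ≤ C * omegaHat ω ((1 + r) / 2)) (n : ℕ) :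
    ((n:ℝ) + 1) * (natMoment ω (2 * n + 1) - natMoment ω (2 * n + 3)) ≤
      2 * C * natMoment ω (2 * n + 1) := by
  have h1 : ((n:ℝ) + 1) * (natMoment ω (2 * n + 1) - natMoment ω (2 * n + 3)) =
      ∫ s, (((n:ℝ) + 1) * (s ^ (2 * n + 1) - s ^ (2 * n + 3))) * ω s := by
    rw [natMoment, natMoment, ← integral_sub (h.integrable_pow_mul _) (h.integrable_pow_mul _),
      ← integral_const_mul]
    congr 1; funext s; ring
  have hi : Integrable fun s => (((n:ℝ) + 1) * (s ^ (2 * n + 1) - s ^ (2 * n + 3))) * ω s := by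
    refine (((h.integrable_pow_mul (2 * n + 1)).sub (h.integrable_pow_mul (2 * n + 3))).const_mul
      ((n:ℝ) + 1)).congr (ae_of_all _ fun s => ?_)
    simp only [Pi.sub_apply]; ring
  have hi2 : Integrable fun s => (2 * s ^ (n + 1)) * ω s :=
    ((h.integrable_pow_mul (n + 1)).const_mul 2).congr (ae_of_all _ fun s => by ring_nf)
  have h2 : ∫ s, (((n:ℝ) + 1) * (s ^ (2 * n + 1) - s ^ (2 * n + 3))) * ω s ≤
      ∫ s, (2 * s ^ (n + 1)) * ω s := by
    refine h.natMoment_mono_of_le hi hi2 fun s hs => ?_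
    have hs0 := hs.1.le
    have hb : ((n:ℝ) + 1) * s ^ n * (1 - s) ≤ 1 := by
      have hg : (∑ k ∈ Finset.range (n + 1), s ^ k) * (1 - s) = 1 - s ^ (n + 1) := by
        have := geom_sum_mul s (n + 1); linarith
      have hle : ((n:ℝ) + 1) * s ^ n ≤ ∑ k ∈ Finset.range (n + 1), s ^ k := by
        have := Finset.card_nsmul_le_sum (Finset.range (n + 1)) (fun k => s ^ k) (s ^ n)
          fun k hk => pow_le_pow_of_le_one hs0 hs.2.le (Nat.lt_succ_iff.1 (Finset.mem_range.1 hk))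
        simpa using this
      have := mul_le_mul_of_nonneg_right hle (by linarith [hs.2] : (0:ℝ) ≤ 1 - s)
      have := pow_nonneg hs0 (n + 1)
      linarith
    have e : ((n:ℝ) + 1) * (s ^ (2 * n + 1) - s ^ (2 * n + 3)) =
        (((n:ℝ) + 1) * s ^ n * (1 - s)) * ((1 + s) * s ^ (n + 1)) := by ring
    rw [e]
    have hp : 0 ≤ (1 + s) * s ^ (n + 1) := by positivity
    calc _ ≤ 1 * ((1 + s) * s ^ (n + 1)) := mul_le_mul_of_nonneg_right hb hp
      _ ≤ _ := by
        rw [one_mul]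
        exact mul_le_mul_of_nonneg_right (by linarith [hs.2]) (pow_nonneg hs0 _)
  have h3 : ∫ s, (2 * s ^ (n + 1)) * ω s = 2 * natMoment ω (n + 1) := by
    rw [natMoment, ← integral_const_mul]
    congr 1; funext s; ring
  have h4 := h.natMoment_doubling hC hD (n + 1)
  have h5 : natMoment ω (2 * (n + 1)) ≤ natMoment ω (2 * n + 1) :=
    h.natMoment_antitone (by omega)
  rw [h1]
  nlinarith

end NiceWeight

/-- The point `e^{it}` of the unit circle. -/
def unitPt (t : ℝ) : ℂ := Complex.exp ((t:ℂ) * Complex.I)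

lemma continuous_unitPt : Continuous unitPt := by unfold unitPt; fun_prop

lemma norm_unitPt (t : ℝ) : ‖unitPt t‖ = 1 := Complex.norm_exp_ofReal_mul_I t

lemma unitPt_pow (t : ℝ) (n : ℕ) : unitPt t ^ n = Complex.exp ((n:ℂ) * Complex.I * t) := by
  rw [unitPt, ← Complex.exp_nat_mul]; ring_nf

lemma exp_nat_mul_two_pi (n : ℕ) :
    Complex.exp ((n:ℂ) * Complex.I * ((2 * Real.pi : ℝ) : ℂ)) = 1 := by
  have := Complex.exp_nat_mul_two_pi_mul_I n
  rw [← this]; push_cast; ring_nf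

/-- Termwise integration of an absolutely convergent power series on the circle against a
continuous function. -/
lemma hasSum_integral_mul_unitPt {g : ℝ → ℂ} (hg : Continuous g) {M : ℝ}
    (hM : ∀ t ∈ Ioc (0:ℝ) (2 * Real.pi), ‖g t‖ ≤ M) {c : ℕ → ℂ} (hc : Summable fun n => ‖c n‖) :
    HasSum (fun n => c n * ∫ t in (0:ℝ)..(2 * Real.pi), g t * unitPt t ^ n)
      (∫ t in (0:ℝ)..(2 * Real.pi), g t * ∑' n, c n * unitPt t ^ n) := by
  have hpi : (0:ℝ) ≤ 2 * Real.pi := Real.two_pi_pos.le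
  have hs : ∀ t, Summable fun n => c n * unitPt t ^ n := fun t =>
    Summable.of_norm (by simpa [norm_unitPt] using hc)
  have key := intervalIntegral.hasSum_integral_of_dominated_convergence (μ := volume)
    (a := 0) (b := 2 * Real.pi)
    (F := fun n t => g t * (c n * unitPt t ^ n)) (f := fun t => g t * ∑' n, c n * unitPt t ^ n)
    (fun n _ => M * ‖c n‖)
    (fun n => by
      have := continuous_unitPt
      exact (by fun_prop : Continuous fun t => g t * (c n * unitPt t ^ n)).aestronglyMeasurable)
    (fun n => ae_of_all _ fun t ht => by
      rw [uIoc_of_le hpi] at ht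
      simp only [norm_mul, norm_pow, norm_unitPt, one_pow, mul_one]
      exact mul_le_mul_of_nonneg_right (hM t ht) (norm_nonneg _))
    (ae_of_all _ fun t _ => hc.mul_left M)
    intervalIntegrable_const
    (ae_of_all _ fun t _ => (hs t).hasSum.mul_left (g t))
  have e : ∀ n, ∫ t in (0:ℝ)..(2 * Real.pi), g t * (c n * unitPt t ^ n) =
      c n * ∫ t in (0:ℝ)..(2 * Real.pi), g t * unitPt t ^ n := fun n => by
    rw [← intervalIntegral.integral_const_mul]
    congr 1; funext t; ring
  simp_rw [e] at key
  exact key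

lemma continuous_tsum_unitPt {c : ℕ → ℂ} (hc : Summable fun n => ‖c n‖) :
    Continuous fun t => ∑' n, c n * unitPt t ^ n := by
  have := continuous_unitPt
  exact continuous_tsum (fun n => by fun_prop) hc fun n t => by simp [norm_unitPt]

lemma norm_tsum_unitPt_le {c : ℕ → ℂ} (hc : Summable fun n => ‖c n‖) (t : ℝ) :
    ‖∑' n, c n * unitPt t ^ n‖ ≤ ∑' n, ‖c n‖ := by
  have : (fun n => ‖c n * unitPt t ^ n‖) = fun n => ‖c n‖ := by funext n; simp [norm_unitPt]
  have h2 := norm_tsum_le_tsum_norm (f := fun n => c n * unitPt t ^ n) (by rw [this]; exact hc)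
  rwa [this] at h2

lemma integral_unitPt_star_mul (n m : ℕ) :
    ∫ t in (0:ℝ)..(2 * Real.pi), (starRingEnd ℂ) (unitPt t ^ m) * unitPt t ^ n =
      if n = m then ((2 * Real.pi : ℝ) : ℂ) else 0 := by
  have e : ∀ t : ℝ, (starRingEnd ℂ) (unitPt t ^ m) * unitPt t ^ n =
      Complex.exp ((((n:ℂ) - m) * Complex.I) * t) := fun t => by
    rw [unitPt_pow, unitPt_pow, ← Complex.exp_conj, ← Complex.exp_add]
    congr 1
    simp only [map_mul, Complex.conj_I, Complex.conj_ofReal, map_natCast]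
    ring
  simp_rw [e]
  split_ifs with h
  · subst h; simp
  · have hne : ((n:ℂ) - m) * Complex.I ≠ 0 :=
      mul_ne_zero (sub_ne_zero.2 (by exact_mod_cast h)) Complex.I_ne_zero
    rw [integral_exp_mul_complex hne, sub_mul, sub_mul, Complex.exp_sub, exp_nat_mul_two_pi,
      exp_nat_mul_two_pi]
    simp

/-- Parseval's identity for absolutely convergent power series on the circle. -/
lemma parseval_unitPt {c : ℕ → ℂ} (hc : Summable fun n => ‖c n‖) :
    HasSum (fun n => 2 * Real.pi * ‖c n‖ ^ 2)
      (∫ t in (0:ℝ)..(2 * Real.pi), ‖∑' n, c n * unitPt t ^ n‖ ^ 2) := by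
  set f : ℝ → ℂ := fun t => ∑' n, c n * unitPt t ^ n with hf
  have hfc : Continuous f := continuous_tsum_unitPt hc
  have hu := continuous_unitPt
  have h1 : ∀ m, ∫ t in (0:ℝ)..(2 * Real.pi), (starRingEnd ℂ) (unitPt t ^ m) * f t =
      c m * ((2 * Real.pi : ℝ) : ℂ) := fun m => by
    have := hasSum_integral_mul_unitPt (g := fun t => (starRingEnd ℂ) (unitPt t ^ m))
      (by fun_prop) (M := 1) (fun t _ => by simp [norm_unitPt]) hc
    simp_rw [integral_unitPt_star_mul] at this
    refine this.unique ?_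
    convert hasSum_ite_eq m (c m * ((2 * Real.pi : ℝ) : ℂ)) using 2 with n
    split_ifs with hn
    · rw [hn]
    · simp
  have h2 := hasSum_integral_mul_unitPt (g := fun t => (starRingEnd ℂ) (f t))
      (by fun_prop) (M := ∑' n, ‖c n‖)
      (fun t _ => by rw [RCLike.norm_conj]; exact norm_tsum_unitPt_le hc t) hc
  have h3 : ∀ n, ∫ t in (0:ℝ)..(2 * Real.pi), (starRingEnd ℂ) (f t) * unitPt t ^ n =
      (starRingEnd ℂ) (c n * ((2 * Real.pi : ℝ) : ℂ)) := fun n => by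
    rw [← h1 n, intervalIntegral.integral_of_le Real.two_pi_pos.le,
      intervalIntegral.integral_of_le Real.two_pi_pos.le, ← integral_conj]
    congr 1; funext t; simp [mul_comm]
  simp_rw [h3] at h2
  have h4 : (∫ t in (0:ℝ)..(2 * Real.pi), (starRingEnd ℂ) (f t) * f t) =
      ((∫ t in (0:ℝ)..(2 * Real.pi), ‖f t‖ ^ 2 : ℝ) : ℂ) := by
    rw [← intervalIntegral.integral_ofReal]
    congr 1; funext t
    rw [Complex.conj_mul']; push_cast; rfl
  have h5 : ∀ n, c n * (starRingEnd ℂ) (c n * ((2 * Real.pi : ℝ) : ℂ)) =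
      ((2 * Real.pi * ‖c n‖ ^ 2 : ℝ) : ℂ) := fun n => by
    rw [map_mul, Complex.conj_ofReal, ← mul_assoc, Complex.mul_conj']; push_cast; ring
  have h6 : HasSum (fun n => c n * (starRingEnd ℂ) (c n * ((2 * Real.pi : ℝ) : ℂ)))
      (∫ t in (0:ℝ)..(2 * Real.pi), (starRingEnd ℂ) (f t) * f t) := h2
  rw [h4] at h6
  simp_rw [h5] at h6
  exact_mod_cast h6

lemma integral_id_mul_unitPt_pow (k : ℕ) (hk : k ≠ 0) :
    ∫ t in (0:ℝ)..(2 * Real.pi), (t:ℂ) * unitPt t ^ k =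
      ((2 * Real.pi : ℝ) : ℂ) / (Complex.I * k) := by
  have hk' : (k:ℂ) ≠ 0 := by exact_mod_cast hk
  have hI := Complex.I_ne_zero
  have hd : ∀ t : ℝ, HasDerivAt (fun t : ℝ => (t:ℂ) * Complex.exp ((k:ℂ) * Complex.I * t) /
      (Complex.I * k) + Complex.exp ((k:ℂ) * Complex.I * t) / (k:ℂ) ^ 2)
      ((t:ℂ) * unitPt t ^ k) t := fun t => by
    have h0 : HasDerivAt (fun t : ℝ => (t:ℂ)) 1 t := Complex.ofRealCLM.hasDerivAt
    have he : HasDerivAt (fun t : ℝ => Complex.exp ((k:ℂ) * Complex.I * t))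
        (Complex.exp ((k:ℂ) * Complex.I * t) * ((k:ℂ) * Complex.I * 1)) t :=
      (h0.const_mul _).cexp
    refine (((h0.mul he).div_const (Complex.I * k)).add
      (he.div_const ((k:ℂ) ^ 2))).congr_deriv ?_
    rw [unitPt_pow]
    field_simp
    linear_combination Complex.I_sq
  rw [intervalIntegral.integral_eq_sub_of_hasDerivAt (fun t _ => hd t)
    (Continuous.intervalIntegrable (by have := continuous_unitPt; fun_prop) _ _)]
  rw [exp_nat_mul_two_pi]
  simp

/-- Hardy's inequality for power series with nonnegative coefficients. -/
lemma hardy_unitPt {c : ℕ → ℝ} (hc0 : ∀ n, 0 ≤ c n) (hc : Summable c) :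
    ∑' n, c n / (n + 1) ≤
      ∫ t in (0:ℝ)..(2 * Real.pi), ‖∑' n, (c n : ℂ) * unitPt t ^ n‖ := by
  have hpi := Real.pi_pos
  have hc' : Summable fun n => ‖(c n : ℂ)‖ := by simpa [abs_of_nonneg (hc0 _)] using hc
  have hu := continuous_unitPt
  have hfc := continuous_tsum_unitPt hc'
  have hM : ∀ t ∈ Ioc (0:ℝ) (2 * Real.pi), ‖Complex.I * t * unitPt t‖ ≤ 2 * Real.pi :=
    fun t ht => by simpa [norm_unitPt, abs_of_pos ht.1] using ht.2
  have h := hasSum_integral_mul_unitPt (g := fun t => Complex.I * t * unitPt t) (by fun_prop)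
    hM hc'
  have h1 : ∀ n : ℕ, ∫ t in (0:ℝ)..(2 * Real.pi), Complex.I * t * unitPt t * unitPt t ^ n =
      ((2 * Real.pi / (n + 1) : ℝ) : ℂ) := fun n => by
    have : ∀ t : ℝ, Complex.I * t * unitPt t * unitPt t ^ n =
      Complex.I * (t * unitPt t ^ (n + 1)) := fun t => by ring
    simp_rw [this]
    rw [intervalIntegral.integral_const_mul, integral_id_mul_unitPt_pow _ n.succ_ne_zero]
    have : ((n + 1 : ℕ) : ℂ) ≠ 0 := by exact_mod_cast n.succ_ne_zero
    have hI := Complex.I_ne_zero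
    push_cast at this ⊢
    field_simp
  simp_rw [h1] at h
  have h2 : ∀ n : ℕ, (c n : ℂ) * ((2 * Real.pi / (n + 1) : ℝ) : ℂ) =
      ((2 * Real.pi * (c n / (n + 1)) : ℝ) : ℂ) := fun n => by push_cast; ring
  simp_rw [h2] at h
  have h3 := h.tsum_eq
  rw [← Complex.ofReal_tsum, tsum_mul_left] at h3
  have h4 : 2 * Real.pi * ∑' n, c n / ((n:ℝ) + 1) ≤
      2 * Real.pi * ∫ t in (0:ℝ)..(2 * Real.pi), ‖∑' n, (c n : ℂ) * unitPt t ^ n‖ := by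
    calc _ ≤ ‖((2 * Real.pi * ∑' n, c n / ((n:ℝ) + 1) : ℝ) : ℂ)‖ := by
          rw [Complex.norm_real]; exact le_abs_self _
      _ ≤ ∫ t in (0:ℝ)..(2 * Real.pi),
          ‖Complex.I * t * unitPt t * ∑' n, (c n : ℂ) * unitPt t ^ n‖ := by
          rw [h3]; exact intervalIntegral.norm_integral_le_integral_norm Real.two_pi_pos.le
      _ ≤ ∫ t in (0:ℝ)..(2 * Real.pi), 2 * Real.pi * ‖∑' n, (c n : ℂ) * unitPt t ^ n‖ := by
          refine intervalIntegral.integral_mono_on_of_le_Ioo Real.two_pi_pos.le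
            (Continuous.intervalIntegrable (by fun_prop) _ _)
            (Continuous.intervalIntegrable (by fun_prop) _ _) fun t ht => ?_
          rw [norm_mul]
          exact mul_le_mul_of_nonneg_right (hM t ⟨ht.1, ht.2.le⟩) (norm_nonneg _)
      _ = _ := intervalIntegral.integral_const_mul _ _
  exact le_of_mul_le_mul_left h4 Real.two_pi_pos

/-- Taylor coefficients `1 / (2 ω_{2n+1})` of the Bergman kernel. -/
def kerCoeff (ω : ℝ → ℝ) (n : ℕ) : ℝ := 1 / (2 * natMoment ω (2 * n + 1))

/-- The function `w ↦ ∑ wⁿ / (2 ω_{2n+1})` generating the Bergman kernel. -/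
def kerFun (ω : ℝ → ℝ) (w : ℂ) : ℂ := ∑' n : ℕ, (kerCoeff ω n : ℂ) * w ^ n

/-- The integral of `|kerFun ω|` over the circle of radius `ρ`. -/
def kerMean (ω : ℝ → ℝ) (ρ : ℝ) : ℝ :=
  ∫ t in (0:ℝ)..(2 * Real.pi), ‖kerFun ω ((ρ:ℂ) * unitPt t)‖

namespace NiceWeight

variable {ω : ℝ → ℝ}

lemma bergmanKernel_eq (h : NiceWeight ω) (a z : ℂ) :
    bergmanKernel ω a z = kerFun ω (z * (starRingEnd ℂ) a) := by
  unfold bergmanKernel kerFun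
  congr 1; funext n
  rw [h.momentW_eq, kerCoeff]
  push_cast
  ring

lemma kerCoeff_pos (h : NiceWeight ω) (hpos : ∀ r ∈ Ico (0:ℝ) 1, 0 < omegaHat ω r) (n : ℕ) :
    0 < kerCoeff ω n := by
  have := h.natMoment_pos hpos (2 * n + 1)
  unfold kerCoeff; positivity

lemma kerCoeff_monotone (h : NiceWeight ω) (hpos : ∀ r ∈ Ico (0:ℝ) 1, 0 < omegaHat ω r) :
    Monotone (kerCoeff ω) := by
  intro i j hij
  have := h.natMoment_pos hpos (2 * j + 1)
  exact one_div_le_one_div_of_le (by positivity)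
    (mul_le_mul_of_nonneg_left (h.natMoment_antitone (by omega)) (by norm_num))

lemma kerCoeff_diff (h : NiceWeight ω) (hpos : ∀ r ∈ Ico (0:ℝ) 1, 0 < omegaHat ω r)
    {C : ℝ} (hC : 0 < C)
    (hD : ∀ r ∈ Ico (0:ℝ) 1, omegaHat ω r ≤ C * omegaHat ω ((1 + r) / 2)) (n : ℕ) :
    ((n:ℝ) + 1) * (kerCoeff ω (n + 1) - kerCoeff ω n) ≤ 2 * C * kerCoeff ω (n + 1) := by
  have h1 := h.natMoment_pos hpos (2 * n + 1)
  have h2 := h.natMoment_pos hpos (2 * n + 3)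
  have h3 := h.natMoment_diff hC hD n
  unfold kerCoeff
  rw [show 2 * (n + 1) + 1 = 2 * n + 3 by ring]
  set x := natMoment ω (2 * n + 1)
  set y := natMoment ω (2 * n + 3)
  have e1 : ((n:ℝ) + 1) * (1 / (2 * y) - 1 / (2 * x)) = (((n:ℝ) + 1) * (x - y)) / (2 * x * y) := by
    field_simp
  have e2 : 2 * C * (1 / (2 * y)) = (2 * C * x) / (2 * x * y) := by field_simp
  rw [e1, e2]
  gcongr

lemma kerCoeff_mul_pow_le (h : NiceWeight ω) (hpos : ∀ r ∈ Ico (0:ℝ) 1, 0 < omegaHat ω r)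
    {C : ℝ} (hC : 0 < C)
    (hD : ∀ r ∈ Ico (0:ℝ) 1, omegaHat ω r ≤ C * omegaHat ω ((1 + r) / 2))
    {ρ : ℝ} (hρ : ρ ∈ Ico (0:ℝ) 1) (n : ℕ) :
    kerCoeff ω n * ρ ^ n ≤ C ^ 2 / omegaHat ω ρ * ((1 + ρ) / 2) ^ n := by
  obtain ⟨h0, h1⟩ := hρ
  set u := (1 + ρ) / 2 with hu
  set s := (1 + u) / 2 with hs
  have hs34 : 3 / 4 ≤ s := by rw [hs, hu]; linarith
  have hs1 : s < 1 := by rw [hs, hu]; linarith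
  have hu0 : 0 ≤ u := by rw [hu]; linarith
  have hm := h.pow_mul_omegaHat_le (2 * n + 1) (by linarith : 0 ≤ s)
  have hωs := hpos s ⟨by linarith, hs1⟩
  have hωρ := hpos ρ ⟨h0, h1⟩
  have hmp := h.natMoment_pos hpos (2 * n + 1)
  have hdd : omegaHat ω ρ ≤ C ^ 2 * omegaHat ω s := by
    calc _ ≤ C * omegaHat ω u := hD ρ ⟨h0, h1⟩
      _ ≤ C * (C * omegaHat ω s) :=
        mul_le_mul_of_nonneg_left (hD u ⟨hu0, by rw [hu]; linarith⟩) hC.le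
      _ = _ := by ring
  have hρu : ρ ≤ u * u := by rw [hu]; nlinarith [sq_nonneg (1 - ρ)]
  have hus : u ≤ s ^ 2 := by rw [hs]; nlinarith [sq_nonneg (1 - u)]
  have hp : ρ ^ n ≤ s ^ (2 * n) * u ^ n := by
    calc ρ ^ n ≤ (u * u) ^ n := pow_le_pow_left₀ h0 hρu n
      _ = u ^ n * u ^ n := mul_pow _ _ _
      _ ≤ (s ^ 2) ^ n * u ^ n :=
        mul_le_mul_of_nonneg_right (pow_le_pow_left₀ hu0 hus n) (pow_nonneg hu0 n)
      _ = _ := by rw [pow_mul]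
  have hk : kerCoeff ω n * s ^ (2 * n) ≤ C ^ 2 / omegaHat ω ρ := by
    rw [kerCoeff, div_mul_eq_mul_div, one_mul, div_le_div_iff₀ (by positivity) hωρ]
    have hs2 : 0 ≤ s ^ (2 * n) := pow_nonneg (by linarith) _
    calc s ^ (2 * n) * omegaHat ω ρ ≤ s ^ (2 * n) * (C ^ 2 * omegaHat ω s) :=
          mul_le_mul_of_nonneg_left hdd hs2
      _ = C ^ 2 * (s ^ (2 * n) * omegaHat ω s) := by ring
      _ ≤ C ^ 2 * (2 * natMoment ω (2 * n + 1)) := by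
          refine mul_le_mul_of_nonneg_left ?_ (by positivity)
          refine le_trans ?_ (mul_le_mul_of_nonneg_left hm zero_le_two)
          rw [pow_succ]
          have := mul_nonneg hs2 hωs.le
          nlinarith
  calc kerCoeff ω n * ρ ^ n ≤ kerCoeff ω n * (s ^ (2 * n) * u ^ n) :=
        mul_le_mul_of_nonneg_left hp (h.kerCoeff_pos hpos n).le
    _ = kerCoeff ω n * s ^ (2 * n) * u ^ n := by ring
    _ ≤ _ := mul_le_mul_of_nonneg_right hk (pow_nonneg hu0 n)

lemma summable_kerCoeff (h : NiceWeight ω) (hpos : ∀ r ∈ Ico (0:ℝ) 1, 0 < omegaHat ω r)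
    (hD : InDhat ω) {ρ : ℝ} (hρ : ρ ∈ Ico (0:ℝ) 1) :
    Summable fun n => kerCoeff ω n * ρ ^ n := by
  obtain ⟨C, hC, hD⟩ := hD
  refine Summable.of_nonneg_of_le
    (fun n => mul_nonneg (h.kerCoeff_pos hpos n).le (pow_nonneg hρ.1 n))
    (fun n => h.kerCoeff_mul_pow_le hpos hC hD hρ n)
    ((summable_geometric_of_lt_one ?_ ?_).mul_left _)
  · linarith [hρ.1]
  · linarith [hρ.2]

lemma summable_norm_kerCoeff (h : NiceWeight ω) (hpos : ∀ r ∈ Ico (0:ℝ) 1, 0 < omegaHat ω r)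
    (hD : InDhat ω) {ρ : ℝ} (hρ : ρ ∈ Ico (0:ℝ) 1) :
    Summable fun n => ‖((kerCoeff ω n * ρ ^ n : ℝ) : ℂ)‖ := by
  refine (h.summable_kerCoeff hpos hD hρ).congr fun n => ?_
  rw [Complex.norm_real, Real.norm_of_nonneg
    (mul_nonneg (h.kerCoeff_pos hpos n).le (pow_nonneg hρ.1 n))]

lemma kerFun_unitPt (ω : ℝ → ℝ) (ρ t : ℝ) :
    kerFun ω ((ρ:ℂ) * unitPt t) =
      ∑' n, ((kerCoeff ω n * ρ ^ n : ℝ) : ℂ) * unitPt t ^ n := by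
  unfold kerFun
  congr 1; funext n
  push_cast
  rw [mul_pow]; ring

lemma continuousOn_kerFun (h : NiceWeight ω) (hpos : ∀ r ∈ Ico (0:ℝ) 1, 0 < omegaHat ω r)
    (hD : InDhat ω) : ContinuousOn (kerFun ω) (Metric.ball 0 1) := by
  intro w hw
  rw [Metric.mem_ball, dist_zero_right] at hw
  obtain ⟨ρ, hwρ, hρ⟩ := exists_between hw
  have hρ0 : 0 ≤ ρ := (norm_nonneg w).trans hwρ.le
  have hc : ContinuousOn (kerFun ω) (Metric.ball 0 ρ) := by
    refine continuousOn_tsum (fun n => by fun_prop) (h.summable_kerCoeff hpos hD ⟨hρ0, hρ⟩)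
      fun n z hz => ?_
    rw [Metric.mem_ball, dist_zero_right] at hz
    rw [norm_mul, norm_pow, Complex.norm_real, Real.norm_of_nonneg (h.kerCoeff_pos hpos n).le]
    exact mul_le_mul_of_nonneg_left (pow_le_pow_left₀ (norm_nonneg z) hz.le n)
      (h.kerCoeff_pos hpos n).le
  exact (hc.continuousAt (Metric.isOpen_ball.mem_nhds (by simpa using hwρ))).continuousWithinAt

lemma continuous_kerFun_unitPt (h : NiceWeight ω) (hpos : ∀ r ∈ Ico (0:ℝ) 1, 0 < omegaHat ω r)
    (hD : InDhat ω) {ρ : ℝ} (hρ : ρ ∈ Ico (0:ℝ) 1) :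
    Continuous fun t => kerFun ω ((ρ:ℂ) * unitPt t) := by
  simp_rw [kerFun_unitPt]
  exact continuous_tsum_unitPt (h.summable_norm_kerCoeff hpos hD hρ)

lemma kerMean_nonneg (ω : ℝ → ℝ) (ρ : ℝ) : 0 ≤ kerMean ω ρ :=
  intervalIntegral.integral_nonneg Real.two_pi_pos.le fun _ _ => norm_nonneg _

/-- Hardy's inequality for the Bergman kernel. -/
lemma tsum_kerCoeff_le_kerMean (h : NiceWeight ω)
    (hpos : ∀ r ∈ Ico (0:ℝ) 1, 0 < omegaHat ω r)
    (hD : InDhat ω) {ρ : ℝ} (hρ : ρ ∈ Ico (0:ℝ) 1) :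
    ∑' n : ℕ, kerCoeff ω n * ρ ^ n / (n + 1) ≤ kerMean ω ρ := by
  unfold kerMean
  simp_rw [kerFun_unitPt]
  exact hardy_unitPt (fun n => mul_nonneg (h.kerCoeff_pos hpos n).le (pow_nonneg hρ.1 n))
    (h.summable_kerCoeff hpos hD hρ)

lemma kerMean_le_tsum (h : NiceWeight ω)
    (hpos : ∀ r ∈ Ico (0:ℝ) 1, 0 < omegaHat ω r)
    (hD : InDhat ω) {ρ : ℝ} (hρ : ρ ∈ Ico (0:ℝ) 1) :
    kerMean ω ρ ≤ 2 * Real.pi * ∑' n : ℕ, kerCoeff ω n * ρ ^ n := by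
  have hs := h.summable_norm_kerCoeff hpos hD hρ
  have h1 : ∀ t, ‖kerFun ω ((ρ:ℂ) * unitPt t)‖ ≤ ∑' n : ℕ, kerCoeff ω n * ρ ^ n := fun t => by
    rw [kerFun_unitPt]
    refine (norm_tsum_unitPt_le hs t).trans (le_of_eq (tsum_congr fun n => ?_))
    rw [Complex.norm_real, Real.norm_of_nonneg
      (mul_nonneg (h.kerCoeff_pos hpos n).le (pow_nonneg hρ.1 n))]
  have h2 := intervalIntegral.integral_mono_on (a := 0) (b := 2 * Real.pi) (μ := volume)
    Real.two_pi_pos.le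
    ((h.continuous_kerFun_unitPt hpos hD hρ).norm.intervalIntegrable _ _)
    (intervalIntegrable_const (c := ∑' n : ℕ, kerCoeff ω n * ρ ^ n)) fun t _ => h1 t
  simpa [kerMean] using h2

/-- `L¹` estimate for the difference of two dilations of the kernel. -/
lemma integral_kerFun_sub_le (h : NiceWeight ω) (hpos : ∀ r ∈ Ico (0:ℝ) 1, 0 < omegaHat ω r)
    {C : ℝ} (hC : 0 < C)
    (hD : ∀ r ∈ Ico (0:ℝ) 1, omegaHat ω r ≤ C * omegaHat ω ((1 + r) / 2))
    {ρ x : ℝ} (hρ : ρ ∈ Ico (0:ℝ) 1) (hx : x ∈ Ico (0:ℝ) 1) :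
    ∫ t in (0:ℝ)..(2 * Real.pi),
      ‖kerFun ω ((ρ:ℂ) * unitPt t) - kerFun ω (((x * ρ : ℝ):ℂ) * unitPt t)‖ ≤
      3 * Real.pi * ((2 * C + 1) * C ^ 2 * (1 - x) / omegaHat ω ρ) / (1 - ρ) := by
  have hxρ : x * ρ ∈ Ico (0:ℝ) 1 :=
    ⟨mul_nonneg hx.1 hρ.1, by nlinarith [hx.1, hx.2, hρ.1, hρ.2]⟩
  have hD' : InDhat ω := ⟨C, hC, hD⟩
  have hωρ := hpos ρ hρ
  set a := kerCoeff ω with ha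
  have ha0 : ∀ n, 0 < a n := h.kerCoeff_pos hpos
  set D := (2 * C + 1) * C ^ 2 * (1 - x) / omegaHat ω ρ with hDdef
  have hx1 : 0 < 1 - x := by linarith [hx.2]
  have hDpos : 0 < D := by rw [hDdef]; positivity
  set u := (1 + ρ) / 2 with hu
  have hu0 : 0 ≤ u := by rw [hu]; linarith [hρ.1]
  have hu1 : u < 1 := by rw [hu]; linarith [hρ.2]
  set b : ℕ → ℝ := fun n => a n * ρ ^ n - a n * (x * ρ) ^ n with hb
  have hbs : Summable b := (h.summable_kerCoeff hpos hD' hρ).sub (h.summable_kerCoeff hpos hD' hxρ)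
  set e : ℕ → ℝ := fun n => b (n + 1) - ρ * b n with he
  have hb' : ∀ n, b n = ρ ^ n * (a n * (1 - x ^ n)) := fun n => by
    simp only [hb]; rw [mul_pow]; ring
  have he' : ∀ n, e n = ρ ^ (n + 1) *
      ((a (n + 1) - a n) * (1 - x ^ (n + 1)) + a n * x ^ n * (1 - x)) := fun n => by
    simp only [he, hb']; ring
  have hmono : ∀ n, a n ≤ a (n + 1) := fun n => h.kerCoeff_monotone hpos (Nat.le_succ n)
  have hxn : ∀ n : ℕ, 0 ≤ 1 - x ^ n := fun n => by linarith [pow_le_one₀ (n := n) hx.1 hx.2.le]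
  have he0 : ∀ n, 0 ≤ e n := fun n => by
    rw [he']
    exact mul_nonneg (pow_nonneg hρ.1 _) (add_nonneg
      (mul_nonneg (by linarith [hmono n]) (hxn _))
      (mul_nonneg (mul_nonneg (ha0 n).le (pow_nonneg hx.1 n)) hx1.le))
  have hele : ∀ n, e n ≤ D * u ^ n := fun n => by
    have hbern : 1 - x ^ (n + 1) ≤ ((n:ℝ) + 1) * (1 - x) := by
      have := one_add_mul_le_pow (by linarith [hx.1] : (-2:ℝ) ≤ x - 1) (n + 1)
      push_cast at this
      rw [show 1 + (x - 1) = x by ring] at this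
      linarith
    have h1 : (a (n + 1) - a n) * (1 - x ^ (n + 1)) ≤ 2 * C * a (n + 1) * (1 - x) := by
      calc _ ≤ (a (n + 1) - a n) * (((n:ℝ) + 1) * (1 - x)) :=
            mul_le_mul_of_nonneg_left hbern (by linarith [hmono n])
        _ = ((n:ℝ) + 1) * (a (n + 1) - a n) * (1 - x) := by ring
        _ ≤ _ := mul_le_mul_of_nonneg_right (h.kerCoeff_diff hpos hC hD n) hx1.le
    have h2 : a n * x ^ n * (1 - x) ≤ a (n + 1) * (1 - x) := by
      refine mul_le_mul_of_nonneg_right ?_ hx1.le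
      exact (mul_le_of_le_one_right (ha0 n).le (pow_le_one₀ hx.1 hx.2.le)).trans (hmono n)
    have h3 := h.kerCoeff_mul_pow_le hpos hC hD hρ (n + 1)
    have h4 : u ^ (n + 1) ≤ u ^ n := pow_le_pow_of_le_one hu0 hu1.le (Nat.le_succ n)
    rw [he']
    calc _ ≤ ρ ^ (n + 1) * (2 * C * a (n + 1) * (1 - x) + a (n + 1) * (1 - x)) :=
          mul_le_mul_of_nonneg_left (add_le_add h1 h2) (pow_nonneg hρ.1 _)
      _ = (2 * C + 1) * (1 - x) * (a (n + 1) * ρ ^ (n + 1)) := by ring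
      _ ≤ (2 * C + 1) * (1 - x) * (C ^ 2 / omegaHat ω ρ * u ^ n) :=
          mul_le_mul_of_nonneg_left (h3.trans (mul_le_mul_of_nonneg_left h4 (by positivity)))
            (by positivity)
      _ = D * u ^ n := by rw [hDdef]; ring
  have hgs : Summable fun n => D * u ^ n := (summable_geometric_of_lt_one hu0 hu1).mul_left D
  have hes : Summable e := Summable.of_nonneg_of_le he0 hele hgs
  have hens : Summable fun n => ‖(e n : ℂ)‖ := by
    simpa [abs_of_nonneg (he0 _)] using hes
  have hrs : Summable fun n => ‖((ρ ^ n : ℝ) : ℂ)‖ := by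
    refine (summable_geometric_of_lt_one hρ.1 hρ.2).congr fun n => ?_
    rw [Complex.norm_real, Real.norm_of_nonneg (pow_nonneg hρ.1 n)]
  set f : ℝ → ℂ := fun t => ∑' n, ((ρ ^ n : ℝ) : ℂ) * unitPt t ^ n with hf
  set g : ℝ → ℂ := fun t => ∑' n, (e n : ℂ) * unitPt t ^ n with hg
  have hfc : Continuous f := continuous_tsum_unitPt hrs
  have hgc : Continuous g := continuous_tsum_unitPt hens
  have hfac : ∀ t, ‖kerFun ω ((ρ:ℂ) * unitPt t) - kerFun ω (((x * ρ : ℝ):ℂ) * unitPt t)‖ =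
      ‖f t‖ * ‖g t‖ := fun t => by
    have sm : ∀ {c : ℕ → ℂ}, (Summable fun n => ‖c n‖) → Summable fun n => c n * unitPt t ^ n :=
      fun hc => Summable.of_norm (by simpa [norm_unitPt] using hc)
    have hbn : Summable fun n => ‖(b n : ℂ)‖ := by
      simpa using hbs.abs
    have hF : kerFun ω ((ρ:ℂ) * unitPt t) - kerFun ω (((x * ρ : ℝ):ℂ) * unitPt t) =
        ∑' n, (b n : ℂ) * unitPt t ^ n := by
      rw [kerFun_unitPt, kerFun_unitPt, ← (sm (h.summable_norm_kerCoeff hpos hD' hρ)).tsum_sub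
        (sm (h.summable_norm_kerCoeff hpos hD' hxρ))]
      refine tsum_congr fun n => ?_
      simp only [hb]; push_cast; ring
    set S := ∑' n, (b n : ℂ) * unitPt t ^ n with hS
    set z := (ρ:ℂ) * unitPt t with hz
    have hz1 : ‖z‖ < 1 := by
      rw [hz, norm_mul, norm_unitPt, mul_one, Complex.norm_real, Real.norm_of_nonneg hρ.1]
      exact hρ.2
    have hfz : f t = (1 - z)⁻¹ := by
      rw [← tsum_geometric_of_norm_lt_one hz1]
      refine tsum_congr fun n => ?_
      rw [hz, mul_pow]; push_cast; ring
    have hne : 1 - z ≠ 0 := by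
      intro h0
      have : z = 1 := by linear_combination -h0
      rw [this] at hz1; simp at hz1
    have hb1 : Summable fun n => ‖(b (n + 1) : ℂ)‖ := (summable_nat_add_iff 1).2 hbn
    have hS1 : S = unitPt t * ∑' n, (b (n + 1) : ℂ) * unitPt t ^ n := by
      rw [hS, (sm hbn).tsum_eq_zero_add, ← tsum_mul_left]
      have : b 0 = 0 := by simp [hb]
      rw [this]
      simp only [Complex.ofReal_zero, zero_mul, zero_add]
      refine tsum_congr fun n => ?_
      ring
    have hgt : g t = (∑' n, (b (n + 1) : ℂ) * unitPt t ^ n) - ρ * S := by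
      rw [hS, ← tsum_mul_left, ← (sm hb1).tsum_sub ((sm hbn).mul_left _)]
      refine tsum_congr fun n => ?_
      simp only [he]; push_cast; ring
    have hmain : (1 - z) * S = unitPt t * g t := by
      rw [hgt, mul_sub, ← hS1, hz]; ring
    have : S = f t * (unitPt t * g t) := by
      rw [hfz, ← hmain, inv_mul_cancel_left₀ hne]
    rw [hF, this, norm_mul, norm_mul, norm_unitPt, one_mul]
  simp_rw [hfac]
  have hIf : ∫ t in (0:ℝ)..(2 * Real.pi), ‖f t‖ ^ 2 ≤ 2 * Real.pi * (1 / (1 - ρ)) := by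
    rw [one_div]
    refine hasSum_le (fun n => ?_) (parseval_unitPt hrs)
      ((hasSum_geometric_of_lt_one hρ.1 hρ.2).mul_left (2 * Real.pi))
    rw [Complex.norm_real, Real.norm_of_nonneg (pow_nonneg hρ.1 n)]
    refine mul_le_mul_of_nonneg_left ?_ Real.two_pi_pos.le
    exact pow_le_of_le_one (pow_nonneg hρ.1 n) (pow_le_one₀ hρ.1 hρ.2.le) two_ne_zero
  have hIg : ∫ t in (0:ℝ)..(2 * Real.pi), ‖g t‖ ^ 2 ≤ 2 * Real.pi * (D ^ 2 * (2 / (1 - ρ))) := by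
    rw [show 2 / (1 - ρ) = (1 - u)⁻¹ by
      rw [hu, show 1 - (1 + ρ) / 2 = (1 - ρ) / 2 by ring, inv_div]]
    refine hasSum_le (fun n => ?_) (parseval_unitPt hens)
      (((hasSum_geometric_of_lt_one hu0 hu1).mul_left (D ^ 2)).mul_left (2 * Real.pi))
    rw [Complex.norm_real, Real.norm_of_nonneg (he0 n)]
    refine mul_le_mul_of_nonneg_left ?_ Real.two_pi_pos.le
    calc e n ^ 2 ≤ (D * u ^ n) ^ 2 := pow_le_pow_left₀ (he0 n) (hele n) 2
      _ = D ^ 2 * (u ^ n) ^ 2 := mul_pow _ _ _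
      _ ≤ D ^ 2 * u ^ n := mul_le_mul_of_nonneg_left
          (pow_le_of_le_one (pow_nonneg hu0 n) (pow_le_one₀ hu0 hu1.le) two_ne_zero)
          (sq_nonneg D)
  have hpt : ∀ t, ‖f t‖ * ‖g t‖ ≤ (D / 2) * ‖f t‖ ^ 2 + (1 / (2 * D)) * ‖g t‖ ^ 2 := fun t => by
    have : (D / 2) * ‖f t‖ ^ 2 + (1 / (2 * D)) * ‖g t‖ ^ 2 - ‖f t‖ * ‖g t‖ =
        (D * ‖f t‖ - ‖g t‖) ^ 2 / (2 * D) := by field_simp; ring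
    have h2 : 0 ≤ (D * ‖f t‖ - ‖g t‖) ^ 2 / (2 * D) := by positivity
    linarith
  have hρ1 : 0 < 1 - ρ := by linarith [hρ.2]
  calc _ ≤ ∫ t in (0:ℝ)..(2 * Real.pi), ((D / 2) * ‖f t‖ ^ 2 + (1 / (2 * D)) * ‖g t‖ ^ 2) :=
        intervalIntegral.integral_mono_on Real.two_pi_pos.le
          (Continuous.intervalIntegrable (by fun_prop) _ _)
          (Continuous.intervalIntegrable (by fun_prop) _ _) fun t _ => hpt t
    _ = (D / 2) * (∫ t in (0:ℝ)..(2 * Real.pi), ‖f t‖ ^ 2) +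
        (1 / (2 * D)) * ∫ t in (0:ℝ)..(2 * Real.pi), ‖g t‖ ^ 2 := by
        rw [intervalIntegral.integral_add (Continuous.intervalIntegrable (by fun_prop) _ _)
          (Continuous.intervalIntegrable (by fun_prop) _ _),
          intervalIntegral.integral_const_mul, intervalIntegral.integral_const_mul]
    _ ≤ (D / 2) * (2 * Real.pi * (1 / (1 - ρ))) +
        (1 / (2 * D)) * (2 * Real.pi * (D ^ 2 * (2 / (1 - ρ)))) := by gcongr
    _ = _ := by field_simp; ring

end NiceWeight

namespace NiceWeight

variable {ω : ℝ → ℝ}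

lemma kerMean_le_add (h : NiceWeight ω) (hpos : ∀ r ∈ Ico (0:ℝ) 1, 0 < omegaHat ω r)
    (hD : InDhat ω) {ρ ρ₁ : ℝ} (hρ : ρ ∈ Ico (0:ℝ) 1) (hρ₁ : ρ₁ ∈ Ico (0:ℝ) 1) :
    kerMean ω ρ ≤ kerMean ω ρ₁ + ∫ t in (0:ℝ)..(2 * Real.pi),
      ‖kerFun ω ((ρ:ℂ) * unitPt t) - kerFun ω ((ρ₁:ℂ) * unitPt t)‖ := by
  have c := h.continuous_kerFun_unitPt hpos hD hρ
  have c₁ := h.continuous_kerFun_unitPt hpos hD hρ₁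
  have hd : Continuous fun t =>
      ‖kerFun ω ((ρ:ℂ) * unitPt t) - kerFun ω ((ρ₁:ℂ) * unitPt t)‖ := (c.sub c₁).norm
  unfold kerMean
  rw [← intervalIntegral.integral_add (c₁.norm.intervalIntegrable _ _) (hd.intervalIntegrable _ _)]
  refine intervalIntegral.integral_mono_on Real.two_pi_pos.le (c.norm.intervalIntegrable _ _)
    ((c₁.norm.add hd).intervalIntegrable _ _) fun t _ => ?_
  simpa using norm_add_le (kerFun ω ((ρ₁:ℂ) * unitPt t))
    (kerFun ω ((ρ:ℂ) * unitPt t) - kerFun ω ((ρ₁:ℂ) * unitPt t))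

/-- For weights in `D`, the integral means of the Bergman kernel are `O(1/ω̂)`. -/
lemma exists_kerMean_le (h : NiceWeight ω) (hpos : ∀ r ∈ Ico (0:ℝ) 1, 0 < omegaHat ω r)
    (hD : InDhat ω) (hDc : InDcheck ω) :
    ∃ B > 0, ∀ ρ ∈ Ico (0:ℝ) 1, kerMean ω ρ ≤ B / omegaHat ω ρ := by
  have hD' := hD
  obtain ⟨C, hC, hCD⟩ := hD
  obtain ⟨K, hK, c, hc, hcD⟩ := hDc
  have hK0 : 0 < K := by linarith
  have hK2 : 1 / (2 * K) < 1 / 2 := by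
    apply one_div_lt_one_div_of_lt <;> linarith
  have hK3 : 0 < 1 / (2 * K) := by positivity
  set ρ₀ := 1 - 1 / (2 * K) with hρ₀def
  have hρ₀ : ρ₀ ∈ Ico (0:ℝ) 1 := ⟨by linarith, by linarith⟩
  set S := 2 * Real.pi * ∑' n : ℕ, kerCoeff ω n * ρ₀ ^ n with hS
  set B₁ := 6 * Real.pi * ((2 * C + 1) * C ^ 2 * (K - 1)) with hB₁
  have hB₁0 : 0 < B₁ := by
    have : 0 < K - 1 := by linarith
    have := Real.pi_pos
    positivity
  have hc1 : 0 < c - 1 := by linarith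
  set B := S * omegaHat ω 0 + B₁ * c / (c - 1) with hB
  have hω0 := hpos 0 (by simp)
  have hS0 : 0 ≤ S := (kerMean_nonneg ω ρ₀).trans (h.kerMean_le_tsum hpos hD' hρ₀)
  have hB0 : 0 < B := by positivity
  have hbase : ∀ ρ ∈ Ico (0:ℝ) 1, 1 / (2 * K) ≤ 1 - ρ → kerMean ω ρ ≤ B / omegaHat ω ρ := by
    intro ρ hρ hle
    rw [le_div_iff₀ (hpos ρ hρ)]
    have h1 : kerMean ω ρ ≤ S := by
      refine (h.kerMean_le_tsum hpos hD' hρ).trans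
        (mul_le_mul_of_nonneg_left ?_ Real.two_pi_pos.le)
      refine (h.summable_kerCoeff hpos hD' hρ).tsum_le_tsum (fun n => ?_)
        (h.summable_kerCoeff hpos hD' hρ₀)
      exact mul_le_mul_of_nonneg_left (pow_le_pow_left₀ hρ.1 (by linarith) n)
        (h.kerCoeff_pos hpos n).le
    calc kerMean ω ρ * omegaHat ω ρ ≤ S * omegaHat ω 0 :=
          mul_le_mul h1 (h.omegaHat_antitone hρ.1) (hpos ρ hρ).le hS0
      _ ≤ B := le_add_of_nonneg_right (by positivity)
  have hstep : ∀ j : ℕ, ∀ ρ ∈ Ico (0:ℝ) 1, 1 / (2 * K) ≤ (1 - ρ) * K ^ j →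
      kerMean ω ρ ≤ B / omegaHat ω ρ := by
    intro j
    induction j with
    | zero => intro ρ hρ hle; exact hbase ρ hρ (by simpa using hle)
    | succ j ih =>
      intro ρ hρ hle
      by_cases hcase : 1 / (2 * K) ≤ 1 - ρ
      · exact hbase ρ hρ hcase
      push Not at hcase
      have hωρ := hpos ρ hρ
      have h1ρ : 0 < 1 - ρ := by linarith [hρ.2]
      set ρ₁ := 1 - K * (1 - ρ) with hρ₁def
      have hKρ : K * (1 - ρ) < 1 / 2 := by
        calc K * (1 - ρ) < K * (1 / (2 * K)) := mul_lt_mul_of_pos_left hcase hK0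
          _ = 1 / 2 := by field_simp
      have hρ₁ : ρ₁ ∈ Ico (0:ℝ) 1 := ⟨by linarith, by
        have := mul_pos hK0 h1ρ
        linarith⟩
      have hρhalf : 1 / 2 < ρ := by linarith
      have hρ0 : 0 < ρ := by linarith
      have hlt : ρ₁ < ρ := by rw [hρ₁def]; nlinarith
      have hx : ρ₁ / ρ ∈ Ico (0:ℝ) 1 :=
        ⟨div_nonneg hρ₁.1 hρ.1, (div_lt_one hρ0).2 hlt⟩
      have hih := ih ρ₁ hρ₁ (by
        rw [hρ₁def, pow_succ] at *
        calc _ ≤ _ := hle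
          _ = _ := by ring)
      have hdc := hcD ρ₁ hρ₁
      rw [show 1 - (1 - ρ₁) / K = ρ by rw [hρ₁def]; field_simp; ring] at hdc
      have hdiff := h.integral_kerFun_sub_le hpos hC hCD hρ hx
      rw [div_mul_cancel₀ _ hρ0.ne'] at hdiff
      have h1x : 1 - ρ₁ / ρ ≤ 2 * (K - 1) * (1 - ρ) := by
        rw [show 1 - ρ₁ / ρ = (K - 1) * (1 - ρ) / ρ by rw [hρ₁def]; field_simp; ring,
          div_le_iff₀ hρ0]
        have : 0 ≤ (K - 1) * (1 - ρ) := mul_nonneg (by linarith) h1ρ.le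
        nlinarith
      have hdiff' : 3 * Real.pi * ((2 * C + 1) * C ^ 2 * (1 - ρ₁ / ρ) / omegaHat ω ρ) / (1 - ρ)
          ≤ B₁ / omegaHat ω ρ := by
        calc _ ≤ 3 * Real.pi * ((2 * C + 1) * C ^ 2 * (2 * (K - 1) * (1 - ρ)) /
              omegaHat ω ρ) / (1 - ρ) := by gcongr
          _ = _ := by rw [hB₁]; field_simp; ring
      calc kerMean ω ρ ≤ _ := h.kerMean_le_add hpos hD' hρ hρ₁
        _ ≤ B / omegaHat ω ρ₁ + B₁ / omegaHat ω ρ := add_le_add hih (hdiff.trans hdiff')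
        _ ≤ B / (c * omegaHat ω ρ) + B₁ / omegaHat ω ρ := by gcongr
        _ = (B / c + B₁) / omegaHat ω ρ := by field_simp
        _ ≤ B / omegaHat ω ρ := by
          gcongr
          have : B₁ * c / (c - 1) ≤ B := le_add_of_nonneg_left (by positivity)
          rw [div_le_iff₀ hc1] at this
          have : B / c + B₁ - B = (B₁ * c - B * (c - 1)) / c := by field_simp; ring
          have h3 : (B₁ * c - B * (c - 1)) / c ≤ 0 :=
            div_nonpos_of_nonpos_of_nonneg (by linarith) (by linarith)
          linarith
  refine ⟨B, hB0, fun ρ hρ => ?_⟩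
  have h1ρ : 0 < 1 - ρ := by linarith [hρ.2]
  obtain ⟨j, hj⟩ := pow_unbounded_of_one_lt (1 / (2 * K) / (1 - ρ)) hK
  refine hstep j ρ hρ ?_
  rw [div_lt_iff₀ h1ρ] at hj
  linarith

end NiceWeight

namespace NiceWeight

variable {ω : ℝ → ℝ}

/-- The distribution of `ω̂` under the weight is Lebesgue measure. -/
lemma map_omegaHat (h : NiceWeight ω) :
    (weightMeasure ω).map (omegaHat ω) = volume.restrict (Ioc 0 (omegaHat ω 0)) := by
  have := h.weightMeasure_finite
  have hm := h.omegaHat_continuous.measurable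
  have : IsFiniteMeasure ((weightMeasure ω).map (omegaHat ω)) := Measure.isFiniteMeasure_map _ _
  refine Measure.ext_of_Iic _ _ fun u => ?_
  rw [Measure.map_apply hm measurableSet_Iic, Measure.restrict_apply measurableSet_Iic]
  have hI : Iic u ∩ Ioc 0 (omegaHat ω 0) = Ioc 0 (min u (omegaHat ω 0)) := by
    ext x; simp; tauto
  rw [hI, Real.volume_Ioc, sub_zero]
  have h0 := h.omegaHat_nonneg 0
  apply le_antisymm
  · rcases lt_or_ge u 0 with hu | hu
    · have : omegaHat ω ⁻¹' Iic u = ∅ := by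
        ext s; simpa using hu.trans_le (h.omegaHat_nonneg s)
      simp [this]
    have hc : IsCompact (Icc (0:ℝ) 1 ∩ omegaHat ω ⁻¹' Iic u) :=
      isCompact_Icc.inter_right (isClosed_Iic.preimage h.omegaHat_continuous)
    obtain ⟨r, hr, hmin⟩ := hc.exists_isLeast ⟨1, by simp, by simpa [omegaHat_one] using hu⟩
    calc weightMeasure ω (omegaHat ω ⁻¹' Iic u) ≤ weightMeasure ω (Ici r) := by
          refine measure_mono_ae ?_
          filter_upwards [h.weightMeasure_ae] with s hs hsu
          exact hmin ⟨Ioo_subset_Icc_self hs, hsu⟩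
      _ = ENNReal.ofReal (omegaHat ω r) := h.weightMeasure_Ici r
      _ ≤ _ := ENNReal.ofReal_le_ofReal (le_min hr.2 (h.omegaHat_antitone hr.1.1))
  · rcases lt_or_ge u 0 with hu | hu
    · rw [ENNReal.ofReal_of_nonpos ((min_le_left _ _).trans hu.le)]; exact zero_le
    obtain ⟨r, -, hr⟩ : min u (omegaHat ω 0) ∈ omegaHat ω '' Icc 0 1 := by
      refine intermediate_value_Icc' zero_le_one h.omegaHat_continuous.continuousOn ?_
      rw [omegaHat_one]
      exact ⟨le_min hu h0, min_le_right _ _⟩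
    rw [← hr, ← h.weightMeasure_Ici]
    refine measure_mono fun s hs => ?_
    exact (h.omegaHat_antitone hs).trans (hr.le.trans (min_le_left _ _))

/-- Schur-type estimate for the kernel `1 / max (ω̂ r) (ω̂ s)`. -/
lemma lintegral_one_div_max_le (h : NiceWeight ω) {β v : ℝ} (hβ0 : 0 < β) (hβ1 : β < 1)
    (hv : 0 < v) :
    ∫⁻ s, ENNReal.ofReal (omegaHat ω s ^ (-β)) * ENNReal.ofReal (1 / max v (omegaHat ω s))
        ∂weightMeasure ω ≤
      ENNReal.ofReal (1 / (1 - β) + 1 / β) * ENNReal.ofReal (v ^ (-β)) := by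
  set φ : ℝ → ℝ≥0∞ := fun u => ENNReal.ofReal (u ^ (-β)) * ENNReal.ofReal (1 / max v u) with hφ
  have hφm : Measurable φ := by fun_prop
  have hpow : v ^ (1 - β) = v * v ^ (-β) := by
    rw [sub_eq_add_neg, Real.rpow_add hv, Real.rpow_one]
  calc ∫⁻ s, φ (omegaHat ω s) ∂weightMeasure ω
      = ∫⁻ u in Ioc 0 (omegaHat ω 0), φ u := by
        rw [← h.map_omegaHat, lintegral_map hφm h.omegaHat_continuous.measurable]
    _ ≤ ∫⁻ u in Ioc 0 v ∪ Ioi v, φ u := by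
        refine lintegral_mono_set ?_
        rw [Ioc_union_Ioi_eq_Ioi hv.le]
        exact Ioc_subset_Ioi_self
    _ ≤ (∫⁻ u in Ioc 0 v, φ u) + ∫⁻ u in Ioi v, φ u := lintegral_union_le _ _ _
    _ ≤ ENNReal.ofReal (1 / (1 - β) * v ^ (-β)) + ENNReal.ofReal (1 / β * v ^ (-β)) := by
        refine add_le_add ?_ ?_
        · have hi : IntervalIntegrable (fun u : ℝ => u ^ (-β)) volume 0 v :=
            intervalIntegral.intervalIntegrable_rpow' (by linarith)
          have hi' : IntegrableOn (fun u : ℝ => u ^ (-β) * (1 / v)) (Ioc 0 v) :=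
            ((intervalIntegrable_iff_integrableOn_Ioc_of_le hv.le).1 hi).mul_const _
          calc ∫⁻ u in Ioc 0 v, φ u = ∫⁻ u in Ioc 0 v, ENNReal.ofReal (u ^ (-β) * (1 / v)) := by
                refine setLIntegral_congr_fun measurableSet_Ioc fun u hu => ?_
                simp only [hφ]
                rw [max_eq_left hu.2, ← ENNReal.ofReal_mul (Real.rpow_nonneg hu.1.le _)]
            _ = ENNReal.ofReal (∫ u in Ioc 0 v, u ^ (-β) * (1 / v)) := by
                rw [ofReal_integral_eq_lintegral_ofReal hi']
                filter_upwards [ae_restrict_mem measurableSet_Ioc] with u hu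
                exact mul_nonneg (Real.rpow_nonneg hu.1.le _) (by positivity)
            _ ≤ _ := by
                refine ENNReal.ofReal_le_ofReal (le_of_eq ?_)
                rw [integral_mul_const, ← intervalIntegral.integral_of_le hv.le,
                  integral_rpow (Or.inl (by linarith)), Real.zero_rpow (by linarith),
                  show -β + 1 = 1 - β by ring, hpow]
                have : 1 - β ≠ 0 := by linarith
                field_simp
                ring
        · have hi : IntegrableOn (fun u : ℝ => u ^ (-β - 1)) (Ioi v) :=
            integrableOn_Ioi_rpow_of_lt (by linarith) hv
          calc ∫⁻ u in Ioi v, φ u = ∫⁻ u in Ioi v, ENNReal.ofReal (u ^ (-β - 1)) := by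
                refine setLIntegral_congr_fun measurableSet_Ioi fun u hu => ?_
                have hu0 : 0 < u := hv.trans hu
                simp only [hφ]
                rw [max_eq_right (le_of_lt hu), ← ENNReal.ofReal_mul (Real.rpow_nonneg hu0.le _),
                  Real.rpow_sub_one hu0.ne', mul_one_div]
            _ = ENNReal.ofReal (∫ u in Ioi v, u ^ (-β - 1)) := by
                rw [ofReal_integral_eq_lintegral_ofReal hi]
                filter_upwards [ae_restrict_mem measurableSet_Ioi] with u hu
                exact Real.rpow_nonneg (hv.trans hu).le _
            _ ≤ _ := by
                refine ENNReal.ofReal_le_ofReal (le_of_eq ?_)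
                rw [integral_Ioi_rpow_of_lt (by linarith) hv, show -β - 1 + 1 = -β by ring]
                field_simp
    _ = _ := by
        have : 0 ≤ v ^ (-β) := Real.rpow_nonneg hv.le _
        have : 0 < 1 - β := by linarith
        rw [← ENNReal.ofReal_add (by positivity) (by positivity),
          ← ENNReal.ofReal_mul (by positivity)]
        congr 1; ring

end NiceWeight

section Schur

variable {α β : Type*} [MeasurableSpace α] [MeasurableSpace β]

lemma ENNReal.mul_rpow_one_sub_le {a : ℝ≥0∞} {p : ℝ} (hp : 1 < p) :
    a ^ p * a ^ (1 - p) ≤ a := by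
  rcases eq_or_ne a 0 with rfl | h0
  · simp [ENNReal.zero_rpow_of_pos (by linarith : 0 < p)]
  rcases eq_or_ne a ⊤ with rfl | h1
  · exact le_top
  rw [← ENNReal.rpow_add _ _ h0 h1]
  simp

/-- Weighted Hölder inequality. -/
lemma lintegral_mul_rpow_le {μ : Measure α} {p : ℝ} (hp : 1 < p) {G k w : α → ℝ≥0∞}
    (hG : Measurable G) (hk : Measurable k) (hw : Measurable w)
    (hw0 : ∀ᵐ y ∂μ, w y = 0 → G y = 0) (hwt : ∀ᵐ y ∂μ, w y ≠ ⊤) :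
    (∫⁻ y, G y * k y ∂μ) ^ p ≤
      (∫⁻ y, G y ^ p * w y ^ (1 - p) * k y ∂μ) * (∫⁻ y, w y * k y ∂μ) ^ (p - 1) := by
  have hp0 : 0 < p := by linarith
  have hpq : p.HolderConjugate p.conjExponent := Real.HolderConjugate.conjExponent hp
  set q := p.conjExponent with hq
  have hq0 : 0 < q := hpq.symm.pos
  have hqinv : 1 / q = 1 - 1 / p := by
    have := hpq.inv_add_inv_eq_one
    rw [one_div, one_div]; linarith
  have h1p : 0 < 1 / p := by positivity
  have h1q : 0 < 1 / q := by positivity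
  have hH := ENNReal.lintegral_mul_le_Lp_mul_Lq μ hpq
    (f := fun y => G y * w y ^ (-(1 / q)) * k y ^ (1 / p)) (g := fun y => w y ^ (1 / q) * k y ^ (1 / q))
    (by fun_prop) (by fun_prop)
  have e1 : ∫⁻ y, G y * k y ∂μ ≤ ∫⁻ y, ((fun y => G y * w y ^ (-(1 / q)) * k y ^ (1 / p)) *
      fun y => w y ^ (1 / q) * k y ^ (1 / q)) y ∂μ := by
    refine lintegral_mono_ae ?_
    filter_upwards [hw0, hwt] with y h0 ht
    rcases eq_or_ne (w y) 0 with hz | hz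
    · simp [h0 hz]
    simp only [Pi.mul_apply]
    have hww : w y ^ (-(1 / q)) * w y ^ (1 / q) = 1 := by
      rw [← ENNReal.rpow_add _ _ hz ht]; simp
    have hkk : k y ^ (1 / p) * k y ^ (1 / q) = k y := by
      rw [← ENNReal.rpow_add_of_nonneg _ _ h1p.le h1q.le, hqinv]; simp
    calc G y * k y = G y * (w y ^ (-(1 / q)) * w y ^ (1 / q)) *
          (k y ^ (1 / p) * k y ^ (1 / q)) := by rw [hww, hkk, mul_one]
      _ ≤ _ := le_of_eq (by ring)
  have e2 : ∀ y, (G y * w y ^ (-(1 / q)) * k y ^ (1 / p)) ^ p = G y ^ p * w y ^ (1 - p) * k y := by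
    intro y
    rw [ENNReal.mul_rpow_of_nonneg _ _ hp0.le, ENNReal.mul_rpow_of_nonneg _ _ hp0.le,
      ← ENNReal.rpow_mul, ← ENNReal.rpow_mul, one_div_mul_cancel hp0.ne', ENNReal.rpow_one, hqinv]
    congr 3
    field_simp; ring
  have e3 : ∀ y, (w y ^ (1 / q) * k y ^ (1 / q)) ^ q = w y * k y := by
    intro y
    rw [ENNReal.mul_rpow_of_nonneg _ _ hq0.le, ← ENNReal.rpow_mul, ← ENNReal.rpow_mul,
      one_div_mul_cancel hq0.ne', ENNReal.rpow_one, ENNReal.rpow_one]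
  simp only [e2, e3] at hH
  calc _ ≤ _ := ENNReal.rpow_le_rpow (e1.trans hH) hp0.le
    _ = _ := by
      rw [ENNReal.mul_rpow_of_nonneg _ _ hp0.le, ← ENNReal.rpow_mul, ← ENNReal.rpow_mul,
        one_div_mul_cancel hp0.ne', ENNReal.rpow_one, hqinv]
      congr 2
      field_simp

/-- A Minkowski–Young inequality for integral operators whose kernels have
uniformly bounded marginals. -/
lemma lintegral_rpow_lintegral_lintegral_le {ν : Measure α} {m : Measure β} [SFinite ν] [SFinite m]
    {p : ℝ} (hp : 1 < p) {F : α → β → ℝ≥0∞} {κ : α → β → β → ℝ≥0∞} {M : α → ℝ≥0∞}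
    (hF : Measurable (Function.uncurry F))
    (hκ : Measurable fun x : (α × β) × β => κ x.1.1 x.1.2 x.2)
    (hκ1 : ∀ᵐ s ∂ν, ∀ θ, ∫⁻ φ, κ s φ θ ∂m ≤ M s)
    (hκ2 : ∀ᵐ s ∂ν, ∀ φ, ∫⁻ θ, κ s φ θ ∂m ≤ M s)
    (hA : ∀ᵐ s ∂ν, (∫⁻ φ, F s φ ^ p ∂m) ^ (1 / p) ≠ ⊤) :
    ∫⁻ θ, (∫⁻ s, ∫⁻ φ, F s φ * κ s φ θ ∂m ∂ν) ^ p ∂m ≤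
      (∫⁻ s, (∫⁻ φ, F s φ ^ p ∂m) ^ (1 / p) * M s ∂ν) ^ p := by
  have hp0 : 0 < p := by linarith
  set A : α → ℝ≥0∞ := fun s => (∫⁻ φ, F s φ ^ p ∂m) ^ (1 / p) with hAdef
  have hFs : ∀ s, Measurable (F s) := fun s => hF.comp measurable_prodMk_left
  have hFp : Measurable (Function.uncurry fun s φ => F s φ ^ p) := hF.pow_const p
  have hAm : Measurable A := (hFp.lintegral_prod_right').pow_const _
  set I := ∫⁻ s, A s * M s ∂ν with hI
  have hκθ : ∀ θ, Measurable fun y : α × β => κ y.1 y.2 θ := fun θ =>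
    hκ.comp (measurable_id.prodMk measurable_const)
  have hAm' : Measurable fun y : α × β => A y.1 := hAm.comp measurable_fst
  have hw0 : ∀ᵐ y ∂ν.prod m, A y.1 = 0 → Function.uncurry F y = 0 := by
    rw [Measure.ae_prod_iff_ae_ae]
    · refine Eventually.of_forall fun s => ?_
      rcases eq_or_ne (A s) 0 with h0 | h0
      · have h1 : ∫⁻ φ, F s φ ^ p ∂m = 0 := by
          simpa [hAdef, hp0, hp0.le, hp0.not_gt] using h0
        rw [lintegral_eq_zero_iff ((hFs s).pow_const p)] at h1
        filter_upwards [h1] with φ hφ _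
        simpa [hp0, hp0.le, hp0.not_gt] using hφ
      · exact Eventually.of_forall fun φ h => absurd h h0
    · exact (measurableSet_eq_fun hAm' measurable_const).imp (measurableSet_eq_fun hF measurable_const)
  have hwt : ∀ᵐ y ∂ν.prod m, A y.1 ≠ ⊤ := Measure.quasiMeasurePreserving_fst.ae hA
  have hstep : ∀ θ, (∫⁻ s, ∫⁻ φ, F s φ * κ s φ θ ∂m ∂ν) ^ p ≤
      (∫⁻ y, Function.uncurry F y ^ p * A y.1 ^ (1 - p) * κ y.1 y.2 θ ∂ν.prod m) * I ^ (p - 1) := by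
    intro θ
    have h1 := lintegral_mul_rpow_le hp hF (hκθ θ) hAm' hw0 hwt
    have h2 : ∫⁻ s, ∫⁻ φ, F s φ * κ s φ θ ∂m ∂ν =
        ∫⁻ y, Function.uncurry F y * κ y.1 y.2 θ ∂ν.prod m := by
      have h4 : Measurable fun y => Function.uncurry F y * κ y.1 y.2 θ := hF.mul (hκθ θ)
      rw [lintegral_prod _ h4.aemeasurable]; rfl
    rw [h2]
    refine h1.trans (mul_le_mul_right (ENNReal.rpow_le_rpow ?_ (by linarith)) _)
    have h5 : Measurable fun y : α × β => A y.1 * κ y.1 y.2 θ := hAm'.mul (hκθ θ)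
    rw [lintegral_prod _ h5.aemeasurable]
    refine lintegral_mono_ae ?_
    filter_upwards [hκ1] with s hs
    have h6 : Measurable fun φ => κ s φ θ := (hκθ θ).comp measurable_prodMk_left
    rw [lintegral_const_mul _ h6]
    exact mul_le_mul_right (hs θ) _
  have hw : Measurable fun y : α × β => Function.uncurry F y ^ p * A y.1 ^ (1 - p) :=
    (hF.pow_const p).mul (hAm'.pow_const _)
  have hmeas : Measurable fun x : (α × β) × β =>
      Function.uncurry F x.1 ^ p * A x.1.1 ^ (1 - p) * κ x.1.1 x.1.2 x.2 :=
    (hw.comp measurable_fst).mul hκ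
  calc _ ≤ ∫⁻ θ, (∫⁻ y, Function.uncurry F y ^ p * A y.1 ^ (1 - p) * κ y.1 y.2 θ ∂ν.prod m) *
        I ^ (p - 1) ∂m := lintegral_mono hstep
    _ = (∫⁻ θ, ∫⁻ y, Function.uncurry F y ^ p * A y.1 ^ (1 - p) * κ y.1 y.2 θ ∂ν.prod m ∂m) *
        I ^ (p - 1) := lintegral_mul_const _ hmeas.lintegral_prod_left'
    _ ≤ I * I ^ (p - 1) := by
        refine mul_le_mul_left ?_ _
        have hmeas' : Measurable (Function.uncurry fun (θ : β) (y : α × β) =>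
            Function.uncurry F y ^ p * A y.1 ^ (1 - p) * κ y.1 y.2 θ) := hmeas.comp measurable_swap
        rw [lintegral_lintegral_swap hmeas'.aemeasurable]
        have h3 : ∀ y : α × β, ∫⁻ θ, Function.uncurry F y ^ p * A y.1 ^ (1 - p) * κ y.1 y.2 θ ∂m =
            Function.uncurry F y ^ p * A y.1 ^ (1 - p) * ∫⁻ θ, κ y.1 y.2 θ ∂m := fun y =>
          lintegral_const_mul _ (hκ.comp measurable_prodMk_left)
        simp_rw [h3]
        have h6 : Measurable fun y : α × β => Function.uncurry F y ^ p * A y.1 ^ (1 - p) *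
            ∫⁻ θ, κ y.1 y.2 θ ∂m := hw.mul hκ.lintegral_prod_right'
        rw [lintegral_prod _ h6.aemeasurable]
        refine lintegral_mono_ae ?_
        filter_upwards [hκ2] with s hs
        calc _ ≤ ∫⁻ φ, F s φ ^ p * (A s ^ (1 - p) * M s) ∂m := by
              refine lintegral_mono fun φ => ?_
              rw [← mul_assoc]
              exact mul_le_mul_right (hs φ) _
          _ = A s ^ p * A s ^ (1 - p) * M s := by
              rw [lintegral_mul_const _ ((hFs s).pow_const p), mul_assoc,
                show A s ^ p = ∫⁻ φ, F s φ ^ p ∂m by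
                  rw [hAdef, ← ENNReal.rpow_mul, one_div_mul_cancel hp0.ne', ENNReal.rpow_one]]
          _ ≤ A s * M s := mul_le_mul_left (ENNReal.mul_rpow_one_sub_le hp) _
    _ = I ^ p := by
        nth_rewrite 1 [← ENNReal.rpow_one I]
        rw [← ENNReal.rpow_add_of_nonneg _ _ zero_le_one (by linarith)]
        congr 1; ring

/-- Schur's test. -/
lemma lintegral_rpow_lintegral_le_of_schur {ν : Measure α} [SFinite ν] {q : ℝ} (hq : 1 < q)
    {A w : α → ℝ≥0∞} {k : α → α → ℝ≥0∞} {C : ℝ≥0∞} (hA : Measurable A) (hw : Measurable w)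
    (hk : Measurable (Function.uncurry k)) (hw0 : ∀ᵐ s ∂ν, w s ≠ 0) (hwt : ∀ᵐ s ∂ν, w s ≠ ⊤)
    (h1 : ∀ᵐ r ∂ν, ∫⁻ s, w s * k r s ∂ν ≤ C * w r)
    (h2 : ∀ᵐ s ∂ν, ∫⁻ r, w r ^ (q - 1) * k r s ∂ν ≤ C * w s ^ (q - 1)) :
    ∫⁻ r, (∫⁻ s, A s * k r s ∂ν) ^ q ∂ν ≤ C ^ q * ∫⁻ s, A s ^ q ∂ν := by
  have hq0 : 0 < q := by linarith
  have hq1 : 0 ≤ q - 1 := by linarith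
  have hkr : ∀ r, Measurable (k r) := fun r => hk.comp measurable_prodMk_left
  have hks : ∀ s, Measurable fun r => k r s := fun s => hk.comp measurable_prodMk_right
  have hm : Measurable fun x : α × α => w x.1 ^ (q - 1) * (A x.2 ^ q * w x.2 ^ (1 - q) * k x.1 x.2) :=
    ((hw.comp measurable_fst).pow_const _).mul
      ((((hA.comp measurable_snd).pow_const _).mul ((hw.comp measurable_snd).pow_const _)).mul hk)
  have hstep : ∀ᵐ r ∂ν, (∫⁻ s, A s * k r s ∂ν) ^ q ≤
      C ^ (q - 1) * ∫⁻ s, w r ^ (q - 1) * (A s ^ q * w s ^ (1 - q) * k r s) ∂ν := by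
    filter_upwards [h1] with r hr
    have h3 := lintegral_mul_rpow_le (μ := ν) hq hA (hkr r) hw
      (by filter_upwards [hw0] with s hs h; exact absurd h hs) hwt
    calc _ ≤ _ := h3
      _ ≤ (∫⁻ s, A s ^ q * w s ^ (1 - q) * k r s ∂ν) * (C * w r) ^ (q - 1) :=
          mul_le_mul_right (ENNReal.rpow_le_rpow hr hq1) _
      _ = _ := by
          have h4 : Measurable fun s => A s ^ q * w s ^ (1 - q) * k r s :=
            ((hA.pow_const _).mul (hw.pow_const _)).mul (hkr r)
          rw [lintegral_const_mul _ h4,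
            ENNReal.mul_rpow_of_nonneg _ _ hq1]
          ring
  calc _ ≤ ∫⁻ r, C ^ (q - 1) *
        ∫⁻ s, w r ^ (q - 1) * (A s ^ q * w s ^ (1 - q) * k r s) ∂ν ∂ν := lintegral_mono_ae hstep
    _ = C ^ (q - 1) * ∫⁻ s, ∫⁻ r, w r ^ (q - 1) * (A s ^ q * w s ^ (1 - q) * k r s) ∂ν ∂ν := by
        rw [lintegral_const_mul _ hm.lintegral_prod_right', lintegral_lintegral_swap hm.aemeasurable]
    _ ≤ C ^ (q - 1) * ∫⁻ s, C * A s ^ q ∂ν := by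
        refine mul_le_mul_right (lintegral_mono_ae ?_) _
        filter_upwards [h2, hw0, hwt] with s hs h0 ht
        calc _ = ∫⁻ r, A s ^ q * w s ^ (1 - q) * (w r ^ (q - 1) * k r s) ∂ν := by
              refine lintegral_congr fun r => by ring
          _ = A s ^ q * w s ^ (1 - q) * ∫⁻ r, w r ^ (q - 1) * k r s ∂ν :=
              lintegral_const_mul _ ((hw.pow_const _).mul (hks s))
          _ ≤ A s ^ q * w s ^ (1 - q) * (C * w s ^ (q - 1)) := mul_le_mul_right hs _
          _ = C * A s ^ q * (w s ^ (1 - q) * w s ^ (q - 1)) := by ring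
          _ = C * A s ^ q := by
              rw [← ENNReal.rpow_add _ _ h0 ht]; simp
    _ = _ := by
        rw [lintegral_const_mul _ (hA.pow_const q), ← mul_assoc]
        congr 1
        nth_rewrite 2 [← ENNReal.rpow_one C]
        rw [← ENNReal.rpow_add_of_nonneg _ _ hq1 zero_le_one]
        congr 1; ring

end Schur

section Polar

lemma circlePt_eq (r θ : ℝ) : circlePt r θ = (r:ℂ) * unitPt θ := rfl

lemma norm_circlePt {r : ℝ} (hr : 0 ≤ r) (θ : ℝ) : ‖circlePt r θ‖ = r := by
  rw [circlePt_eq, norm_mul, norm_unitPt, mul_one, Complex.norm_real, Real.norm_of_nonneg hr]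

lemma circlePt_mem_ball {r : ℝ} (hr : r ∈ Ioo (0:ℝ) 1) (θ : ℝ) :
    circlePt r θ ∈ Metric.ball (0:ℂ) 1 := by
  rw [mem_ball_zero_iff, norm_circlePt hr.1.le]; exact hr.2

lemma continuous_circlePt : Continuous fun x : ℝ × ℝ => circlePt x.1 x.2 := by
  unfold circlePt; fun_prop

lemma unitPt_periodic : Function.Periodic unitPt (2 * Real.pi) := fun t => by
  unfold unitPt
  push_cast
  rw [add_mul]
  exact Complex.exp_periodic _

lemma unitPt_sub (a b : ℝ) : unitPt a * (starRingEnd ℂ) (unitPt b) = unitPt (a - b) := by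
  unfold unitPt
  rw [← Complex.exp_conj, ← Complex.exp_add]
  congr 1
  simp
  ring

lemma Function.Periodic.setLIntegral_Ioo {f : ℝ → ℝ≥0∞} {T : ℝ} (hf : Function.Periodic f T)
    (hT : 0 < T) (a b : ℝ) : ∫⁻ x in Ioo a (a + T), f x = ∫⁻ x in Ioo b (b + T), f x := by
  rw [setLIntegral_congr Ioo_ae_eq_Ioc, setLIntegral_congr Ioo_ae_eq_Ioc]
  have : VAddInvariantMeasure (AddSubgroup.zmultiples T) ℝ volume :=
    ⟨fun c s _ => measure_preimage_add _ _ _⟩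
  refine (isAddFundamentalDomain_Ioc hT a).setLIntegral_eq (isAddFundamentalDomain_Ioc hT b) f ?_
  rintro ⟨g, hg⟩ x
  obtain ⟨n, rfl⟩ := AddSubgroup.mem_zmultiples_iff.1 hg
  rw [AddSubgroup.vadd_def, vadd_eq_add, add_comm]
  exact hf.zsmul n x

lemma Function.Periodic.setLIntegral_comp_sub {f : ℝ → ℝ≥0∞} {T : ℝ} (hf : Function.Periodic f T)
    (hT : 0 < T) (c : ℝ) : ∫⁻ x in Ioo 0 T, f (x - c) = ∫⁻ x in Ioo 0 T, f x := by
  have h1 := (measurePreserving_sub_right volume c).setLIntegral_comp_preimage_emb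
    (measurableEmbedding_subRight c) f (Ioo (-c) (-c + T))
  rw [preimage_sub_const_Ioo, neg_add_cancel, show -c + T + c = T by ring] at h1
  rw [h1, hf.setLIntegral_Ioo hT (-c) 0, zero_add]

lemma Function.Periodic.setLIntegral_comp_sub_left {f : ℝ → ℝ≥0∞} {T : ℝ}
    (hf : Function.Periodic f T) (hT : 0 < T) (c : ℝ) :
    ∫⁻ x in Ioo 0 T, f (c - x) = ∫⁻ x in Ioo 0 T, f x := by
  have h1 := (Measure.measurePreserving_sub_left volume c).setLIntegral_comp_preimage_emb
    (measurableEmbedding_subLeft c) f (Ioo (c - T) (c - T + T))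
  rw [preimage_const_sub_Ioo, sub_add_cancel, sub_self, sub_sub_cancel] at h1
  rw [h1]
  have := hf.setLIntegral_Ioo hT (c - T) 0
  rwa [sub_add_cancel, zero_add] at this

/-- Integration over the unit disc in polar coordinates. -/
lemma setLIntegral_ball_eq {H : ℂ → ℝ≥0∞} (hH : Measurable H) :
    ∫⁻ ζ in Metric.ball (0:ℂ) 1, H ζ =
      ∫⁻ s in Ioo (0:ℝ) 1, ∫⁻ φ in Ioo 0 (2 * Real.pi),
        ENNReal.ofReal s * H (circlePt s φ) := by
  set H' := (Metric.ball (0:ℂ) 1).indicator H with hH'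
  have hH'm : Measurable H' := hH.indicator measurableSet_ball
  have hcm : Measurable fun x : ℝ × ℝ => ENNReal.ofReal x.1 * H' (circlePt x.1 x.2) :=
    (measurable_fst.ennreal_ofReal).mul (hH'm.comp continuous_circlePt.measurable)
  rw [← lintegral_indicator measurableSet_ball, ← Complex.lintegral_comp_polarCoord_symm]
  have h1 : ∀ p : ℝ × ℝ, ENNReal.ofReal p.1 • H' (Complex.polarCoord.symm p) =
      ENNReal.ofReal p.1 * H' (circlePt p.1 p.2) := fun p => by
    rw [Complex.polarCoord_symm_apply, circlePt, Complex.exp_mul_I, smul_eq_mul]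
    push_cast
    rfl
  simp_rw [← hH', h1]
  rw [polarCoord_target, Measure.volume_eq_prod, ← Measure.prod_restrict,
    lintegral_prod _ hcm.aemeasurable]
  have h2 : ∀ s ∈ Ioi (0:ℝ), ∫⁻ φ in Ioo (-Real.pi) Real.pi, ENNReal.ofReal s * H' (circlePt s φ) =
      (Iio (1:ℝ)).indicator (fun s => ∫⁻ φ in Ioo 0 (2 * Real.pi),
        ENNReal.ofReal s * H (circlePt s φ)) s := by
    intro s hs
    by_cases h1s : s < 1
    · rw [indicator_of_mem (by exact h1s)]
      have hper : Function.Periodic (fun φ => ENNReal.ofReal s * H (circlePt s φ))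
          (2 * Real.pi) := fun φ => by simp only [circlePt_eq, unitPt_periodic φ]
      have := hper.setLIntegral_Ioo Real.two_pi_pos (-Real.pi) 0
      rw [show -Real.pi + 2 * Real.pi = Real.pi by ring, zero_add] at this
      rw [← this]
      simp_rw [hH', indicator_of_mem (circlePt_mem_ball ⟨hs, h1s⟩ _)]
    · rw [indicator_of_notMem (by exact h1s)]
      have : ∀ φ, H' (circlePt s φ) = 0 := fun φ => by
        rw [hH', indicator_of_notMem]
        rwa [mem_ball_zero_iff, norm_circlePt (le_of_lt hs)]
      simp [this]
  rw [setLIntegral_congr_fun measurableSet_Ioi h2, lintegral_indicator measurableSet_Iio,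
    Measure.restrict_restrict measurableSet_Iio, inter_comm, Ioi_inter_Iio]

/-- A property holding almost everywhere on the disc holds almost everywhere on
almost every circle. -/
lemma ae_circlePt_of_ae_ball {P : ℂ → Prop}
    (hP : ∀ᵐ ζ ∂volume.restrict (Metric.ball (0:ℂ) 1), P ζ) :
    ∀ᵐ s ∂volume.restrict (Ioo (0:ℝ) 1), ∀ᵐ φ ∂volume.restrict (Ioo 0 (2 * Real.pi)),
      P (circlePt s φ) := by
  obtain ⟨N, hPN, hNm, hN⟩ := exists_measurable_superset_of_null (ae_iff.1 hP)
  have hHm : Measurable (N.indicator fun _ => (1:ℝ≥0∞)) := measurable_const.indicator hNm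
  have h0 := setLIntegral_ball_eq hHm
  rw [lintegral_indicator hNm, lintegral_one, Measure.restrict_apply_univ, hN] at h0
  have hcm : Measurable fun x : ℝ × ℝ =>
      ENNReal.ofReal x.1 * N.indicator (fun _ => (1:ℝ≥0∞)) (circlePt x.1 x.2) :=
    (measurable_fst.ennreal_ofReal).mul (hHm.comp continuous_circlePt.measurable)
  have h1 := (lintegral_eq_zero_iff hcm.lintegral_prod_right').1 h0.symm
  filter_upwards [h1, ae_restrict_mem measurableSet_Ioo] with s hs hs01
  have hsm : Measurable fun φ =>
      ENNReal.ofReal s * N.indicator (fun _ => (1:ℝ≥0∞)) (circlePt s φ) :=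
    hcm.comp measurable_prodMk_left
  filter_upwards [(lintegral_eq_zero_iff hsm).1 hs] with φ hφ
  by_contra hPφ
  have hmem : circlePt s φ ∈ N := hPN hPφ
  simp [indicator_of_mem hmem, hs01.1.not_ge] at hφ

/-- A property of almost every radius holds almost everywhere on the disc. -/
lemma ae_ball_norm_of_ae {P : ℝ → Prop} (hP : ∀ᵐ s ∂volume.restrict (Ioo (0:ℝ) 1), P s) :
    ∀ᵐ ζ ∂volume.restrict (Metric.ball (0:ℂ) 1), P ‖ζ‖ := by
  obtain ⟨N, hPN, hNm, hN⟩ := exists_measurable_superset_of_null (ae_iff.1 hP)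
  have hMm : MeasurableSet ((fun ζ : ℂ => ‖ζ‖) ⁻¹' N) := measurable_norm hNm
  have h0 := setLIntegral_ball_eq (H := ((fun ζ : ℂ => ‖ζ‖) ⁻¹' N).indicator fun _ => 1)
    (measurable_const.indicator hMm)
  rw [lintegral_indicator hMm, lintegral_one, Measure.restrict_apply_univ] at h0
  have hz : ∀ᵐ s ∂volume.restrict (Ioo (0:ℝ) 1), s ∉ N := by
    rw [ae_iff]; simpa using hN
  rw [ae_iff]
  refine measure_mono_null (t := (fun ζ : ℂ => ‖ζ‖) ⁻¹' N) (fun ζ hζ => hPN hζ) ?_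
  rw [h0]
  refine (lintegral_congr_ae ?_).trans lintegral_zero
  filter_upwards [hz, ae_restrict_mem measurableSet_Ioo] with s hs hs01
  have : ∀ φ, circlePt s φ ∉ (fun ζ : ℂ => ‖ζ‖) ⁻¹' N := fun φ => by
    rwa [mem_preimage, norm_circlePt hs01.1.le]
  simp [indicator_of_notMem (this _)]

end Polar

/-- The radial part `s ω(s) ds` of the measure `ω dA`. -/
def radMeasure (ω : ℝ → ℝ) : Measure ℝ :=
  (volume.restrict (Ioo 0 1)).withDensity fun s => ENNReal.ofReal (s * ω s)

/-- The modulus of the Bergman kernel generating function at `ρ e^{it}`, extended by zero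
outside the disc. -/
def kerAbs (ω : ℝ → ℝ) (ρ t : ℝ) : ℝ≥0∞ :=
  ENNReal.ofReal ‖(Metric.ball (0:ℂ) 1).indicator (kerFun ω) ((ρ:ℂ) * unitPt t)‖

/-- The `Lᵖ` norm of `f` on the circle of radius `s`, with respect to arc length. -/
def circNorm (p : ℝ) (f : ℂ → ℂ) (s : ℝ) : ℝ≥0∞ :=
  (∫⁻ φ in Ioo (0:ℝ) (2 * Real.pi), ENNReal.ofReal ‖f (circlePt s φ)‖ ^ p) ^ (1 / p)

lemma MpE_eq {p : ℝ} (hp : 1 < p) (f : ℂ → ℂ) (s : ℝ) :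
    MpE p s f = ENNReal.ofReal (1 / (2 * Real.pi)) ^ (1 / p) * circNorm p f s := by
  have hp0 : 0 < p := by linarith
  unfold MpE circNorm
  rw [ENNReal.mul_rpow_of_nonneg _ _ (by positivity)]
  simp_rw [ENNReal.ofReal_rpow_of_nonneg (norm_nonneg _) hp0.le]

lemma measurable_circNorm (p : ℝ) {f : ℂ → ℂ} (hf : Measurable f) :
    Measurable (circNorm p f) := by
  have h1 : Measurable fun x : ℝ × ℝ => ENNReal.ofReal ‖f (circlePt x.1 x.2)‖ ^ p :=
    (hf.comp continuous_circlePt.measurable).norm.ennreal_ofReal.pow_const p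
  exact h1.lintegral_prod_right'.pow_const _

lemma LpqNormE_congr (ω : ℝ → ℝ) (p q : ℝ) {f g : ℂ → ℂ}
    (hfg : ∀ᵐ ζ ∂volume.restrict (Metric.ball (0:ℂ) 1), f ζ = g ζ) :
    LpqNormE ω p q f = LpqNormE ω p q g := by
  unfold LpqNormE
  congr 1
  refine lintegral_congr_ae ?_
  filter_upwards [ae_circlePt_of_ae_ball hfg] with s hs
  have : MpE p s f = MpE p s g := by
    unfold MpE
    congr 2
    refine lintegral_congr_ae ?_
    filter_upwards [hs] with φ hφ
    rw [hφ]
  rw [this]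

lemma PomegaPlusL_congr (ω : ℝ → ℝ) {f g : ℂ → ℂ}
    (hfg : ∀ᵐ ζ ∂volume.restrict (Metric.ball (0:ℂ) 1), f ζ = g ζ) :
    PomegaPlusL ω f = PomegaPlusL ω g := by
  funext z
  refine lintegral_congr_ae ?_
  filter_upwards [hfg] with ζ hζ
  rw [hζ]

namespace NiceWeight

variable {ω : ℝ → ℝ}

lemma measurable_radDensity (h : NiceWeight ω) :
    Measurable fun s => ENNReal.ofReal (s * ω s) :=
  (measurable_id.mul h.meas).ennreal_ofReal

lemma lintegral_radMeasure (h : NiceWeight ω) (g : ℝ → ℝ≥0∞) :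
    ∫⁻ s, g s ∂radMeasure ω = ∫⁻ s in Ioo 0 1, ENNReal.ofReal (s * ω s) * g s :=
  lintegral_withDensity_eq_lintegral_mul_non_measurable _ h.measurable_radDensity
    (Eventually.of_forall fun _ => ENNReal.ofReal_lt_top) g

lemma radMeasure_le (h : NiceWeight ω) : radMeasure ω ≤ weightMeasure ω := by
  refine Measure.le_iff.2 fun s hs => ?_
  unfold radMeasure weightMeasure
  rw [withDensity_apply _ hs, withDensity_apply _ hs, Measure.restrict_restrict hs]
  calc _ ≤ ∫⁻ x in s ∩ Ioo 0 1, ENNReal.ofReal (ω x) := by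
        refine setLIntegral_mono' (hs.inter measurableSet_Ioo) fun x hx => ?_
        exact ENNReal.ofReal_le_ofReal (mul_le_of_le_one_left (h.nonneg x) hx.2.2.le)
    _ ≤ _ := lintegral_mono_set inter_subset_left

lemma radMeasure_finite (h : NiceWeight ω) : IsFiniteMeasure (radMeasure ω) :=
  have := h.weightMeasure_finite
  isFiniteMeasure_of_le _ h.radMeasure_le

lemma radMeasure_ae (h : NiceWeight ω) : ∀ᵐ s ∂radMeasure ω, s ∈ Ioo (0:ℝ) 1 :=
  (Measure.absolutelyContinuous_of_le h.radMeasure_le).ae_le h.weightMeasure_ae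

lemma measurable_indicator_kerFun (h : NiceWeight ω)
    (hpos : ∀ r ∈ Ico (0:ℝ) 1, 0 < omegaHat ω r) (hD : InDhat ω) :
    Measurable ((Metric.ball (0:ℂ) 1).indicator (kerFun ω)) := by
  classical
  rw [← piecewise_eq_indicator]
  exact (h.continuousOn_kerFun hpos hD).measurable_piecewise continuousOn_const measurableSet_ball

lemma measurable_kerAbs (h : NiceWeight ω) (hpos : ∀ r ∈ Ico (0:ℝ) 1, 0 < omegaHat ω r)
    (hD : InDhat ω) {α : Type*} [MeasurableSpace α] {u v : α → ℝ} (hu : Measurable u)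
    (hv : Measurable v) : Measurable fun x => kerAbs ω (u x) (v x) := by
  have hc : Measurable fun x => (u x : ℂ) * unitPt (v x) :=
    (Complex.measurable_ofReal.comp hu).mul (continuous_unitPt.measurable.comp hv)
  exact ((h.measurable_indicator_kerFun hpos hD).comp hc).norm.ennreal_ofReal

lemma kerAbs_eq (ω : ℝ → ℝ) {ρ : ℝ} (hρ : ρ ∈ Ico (0:ℝ) 1) (t : ℝ) :
    kerAbs ω ρ t = ENNReal.ofReal ‖kerFun ω ((ρ:ℂ) * unitPt t)‖ := by
  unfold kerAbs
  rw [indicator_of_mem]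
  rw [← circlePt_eq, mem_ball_zero_iff, norm_circlePt hρ.1]
  exact hρ.2

lemma kerAbs_periodic (ω : ℝ → ℝ) (ρ : ℝ) : Function.Periodic (kerAbs ω ρ) (2 * Real.pi) :=
  fun t => by simp only [kerAbs, unitPt_periodic t]

lemma lintegral_kerAbs (h : NiceWeight ω) (hpos : ∀ r ∈ Ico (0:ℝ) 1, 0 < omegaHat ω r)
    (hD : InDhat ω) {ρ : ℝ} (hρ : ρ ∈ Ico (0:ℝ) 1) :
    ∫⁻ t in Ioo 0 (2 * Real.pi), kerAbs ω ρ t = ENNReal.ofReal (kerMean ω ρ) := by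
  simp_rw [kerAbs_eq ω hρ]
  unfold kerMean
  rw [intervalIntegral.integral_of_le Real.two_pi_pos.le, integral_Ioc_eq_integral_Ioo,
    ofReal_integral_eq_lintegral_ofReal _ (Eventually.of_forall fun _ => norm_nonneg _)]
  exact ((h.continuous_kerFun_unitPt hpos hD hρ).norm.integrableOn_Icc).mono_set
    Ioo_subset_Icc_self

lemma PomegaPlusL_circlePt (h : NiceWeight ω) (hpos : ∀ r ∈ Ico (0:ℝ) 1, 0 < omegaHat ω r)
    (hD : InDhat ω) {f : ℂ → ℂ} (hf : Measurable f) {r : ℝ} (hr : r ∈ Ioo (0:ℝ) 1) (θ : ℝ) :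
    PomegaPlusL ω f (circlePt r θ) = ENNReal.ofReal (1 / Real.pi) *
      ∫⁻ s, (∫⁻ φ in Ioo 0 (2 * Real.pi),
        ENNReal.ofReal ‖f (circlePt s φ)‖ * kerAbs ω (r * s) (φ - θ)) ∂radMeasure ω := by
  have hzn : ‖circlePt r θ‖ = r := norm_circlePt hr.1.le θ
  have hHm : Measurable fun ζ : ℂ => ENNReal.ofReal
      (‖f ζ‖ * ‖(Metric.ball (0:ℂ) 1).indicator (kerFun ω) (ζ * (starRingEnd ℂ) (circlePt r θ))‖ *
        ω ‖ζ‖ / Real.pi) := by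
    have h1 : Measurable fun ζ : ℂ =>
        (Metric.ball (0:ℂ) 1).indicator (kerFun ω) (ζ * (starRingEnd ℂ) (circlePt r θ)) :=
      (h.measurable_indicator_kerFun hpos hD).comp (measurable_id.mul_const _)
    exact Measurable.ennreal_ofReal
      (((hf.norm.mul h1.norm).mul (h.meas.comp measurable_norm)).div_const _)
  have e1 : PomegaPlusL ω f (circlePt r θ) = ∫⁻ ζ in Metric.ball (0:ℂ) 1, ENNReal.ofReal
      (‖f ζ‖ * ‖(Metric.ball (0:ℂ) 1).indicator (kerFun ω) (ζ * (starRingEnd ℂ) (circlePt r θ))‖ *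
        ω ‖ζ‖ / Real.pi) := by
    unfold PomegaPlusL
    refine setLIntegral_congr_fun measurableSet_ball fun ζ hζ => ?_
    rw [mem_ball_zero_iff] at hζ
    rw [indicator_of_mem, h.bergmanKernel_eq]
    rw [mem_ball_zero_iff, norm_mul, RCLike.norm_conj, hzn]
    nlinarith [norm_nonneg ζ, hr.1, hr.2]
  rw [e1, setLIntegral_ball_eq hHm, h.lintegral_radMeasure,
    ← lintegral_const_mul' _ _ ENNReal.ofReal_ne_top]
  refine setLIntegral_congr_fun measurableSet_Ioo fun s hs => ?_
  rw [← lintegral_const_mul' _ _ ENNReal.ofReal_ne_top,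
    ← lintegral_const_mul' _ _ ENNReal.ofReal_ne_top]
  refine lintegral_congr fun φ => ?_
  have hprod : circlePt s φ * (starRingEnd ℂ) (circlePt r θ) =
      ((r * s : ℝ) : ℂ) * unitPt (φ - θ) := by
    rw [circlePt_eq, circlePt_eq, map_mul, Complex.conj_ofReal, ← unitPt_sub]
    push_cast; ring
  have hω := h.nonneg s
  have hπ := Real.pi_pos
  have hs0 := hs.1.le
  rw [kerAbs, norm_circlePt hs.1.le, hprod, ← ENNReal.ofReal_mul hs0,
    ← ENNReal.ofReal_mul (norm_nonneg _), ← ENNReal.ofReal_mul (mul_nonneg hs0 hω),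
    ← ENNReal.ofReal_mul (by positivity)]
  congr 1
  ring

lemma MpEE_PomegaPlusL_le (h : NiceWeight ω) (hpos : ∀ r ∈ Ico (0:ℝ) 1, 0 < omegaHat ω r)
    (hD : InDhat ω) {p : ℝ} (hp : 1 < p) {f : ℂ → ℂ} (hf : Measurable f)
    (hA : ∀ᵐ s ∂radMeasure ω, circNorm p f s ≠ ⊤) {r : ℝ} (hr : r ∈ Ioo (0:ℝ) 1) :
    MpEE p r (PomegaPlusL ω f) ≤ ENNReal.ofReal (1 / (2 * Real.pi)) ^ (1 / p) *
      (ENNReal.ofReal (1 / Real.pi) *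
        ∫⁻ s, circNorm p f s * ENNReal.ofReal (kerMean ω (r * s)) ∂radMeasure ω) := by
  have hp0 : 0 < p := by linarith
  have := h.radMeasure_finite
  set I := ∫⁻ s, circNorm p f s * ENNReal.ofReal (kerMean ω (r * s)) ∂radMeasure ω
  have hrs : ∀ s ∈ Ioo (0:ℝ) 1, r * s ∈ Ico (0:ℝ) 1 := fun s hs =>
    ⟨mul_nonneg hr.1.le hs.1.le, by nlinarith [hr.1, hr.2, hs.1, hs.2]⟩
  have hFm : Measurable (Function.uncurry fun s φ => ENNReal.ofReal ‖f (circlePt s φ)‖) :=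
    (hf.comp continuous_circlePt.measurable).norm.ennreal_ofReal
  have hκm : Measurable fun x : (ℝ × ℝ) × ℝ => kerAbs ω (r * x.1.1) (x.1.2 - x.2) :=
    h.measurable_kerAbs hpos hD ((measurable_fst.comp measurable_fst).const_mul r)
      ((measurable_snd.comp measurable_fst).sub measurable_snd)
  have hY := lintegral_rpow_lintegral_lintegral_le (ν := radMeasure ω)
    (m := volume.restrict (Ioo 0 (2 * Real.pi))) hp
    (F := fun s φ => ENNReal.ofReal ‖f (circlePt s φ)‖)
    (κ := fun s φ θ => kerAbs ω (r * s) (φ - θ))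
    (M := fun s => ENNReal.ofReal (kerMean ω (r * s))) hFm hκm
    (by
      filter_upwards [h.radMeasure_ae] with s hs θ
      rw [(kerAbs_periodic ω (r * s)).setLIntegral_comp_sub Real.two_pi_pos,
        h.lintegral_kerAbs hpos hD (hrs s hs)])
    (by
      filter_upwards [h.radMeasure_ae] with s hs φ
      rw [(kerAbs_periodic ω (r * s)).setLIntegral_comp_sub_left Real.two_pi_pos,
        h.lintegral_kerAbs hpos hD (hrs s hs)])
    hA
  unfold MpEE
  rw [ENNReal.mul_rpow_of_nonneg _ _ (by positivity)]
  refine mul_le_mul_right ?_ _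
  simp_rw [h.PomegaPlusL_circlePt hpos hD hf hr, ENNReal.mul_rpow_of_nonneg _ _ hp0.le]
  rw [lintegral_const_mul' _ _ (ENNReal.rpow_ne_top_of_nonneg hp0.le ENNReal.ofReal_ne_top)]
  calc _ ≤ (ENNReal.ofReal (1 / Real.pi) ^ p * I ^ p) ^ (1 / p) :=
        ENNReal.rpow_le_rpow (mul_le_mul_right hY _) (by positivity)
    _ = _ := by
      rw [← ENNReal.mul_rpow_of_nonneg _ _ hp0.le, ← ENNReal.rpow_mul,
        mul_one_div_cancel hp0.ne', ENNReal.rpow_one]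

lemma LpqNormE_eq (h : NiceWeight ω) {p q : ℝ} (hp : 1 < p) (hq : 1 < q) {f : ℂ → ℂ}
    (hf : Measurable f) :
    LpqNormE ω p q f = ENNReal.ofReal (1 / (2 * Real.pi)) ^ (1 / p) *
      (∫⁻ s, circNorm p f s ^ q ∂radMeasure ω) ^ (1 / q) := by
  have hq0 : 0 < q := by linarith
  unfold LpqNormE
  rw [h.lintegral_radMeasure]
  simp_rw [MpE_eq hp, ENNReal.mul_rpow_of_nonneg _ _ hq0.le]
  set c := ENNReal.ofReal (1 / (2 * Real.pi)) ^ (1 / p)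
  have hm : Measurable fun s => ENNReal.ofReal (s * ω s) * circNorm p f s ^ q :=
    h.measurable_radDensity.mul ((measurable_circNorm p hf).pow_const q)
  have : ∀ s, c ^ q * circNorm p f s ^ q * ENNReal.ofReal (s * ω s) =
      c ^ q * (ENNReal.ofReal (s * ω s) * circNorm p f s ^ q) := fun s => by ring
  simp_rw [this]
  rw [lintegral_const_mul _ hm, ENNReal.mul_rpow_of_nonneg _ _ (by positivity), ← ENNReal.rpow_mul,
    mul_one_div_cancel hq0.ne', ENNReal.rpow_one]

/-- The operator with kernel `1 / max (ω̂ r) (ω̂ s)` is bounded on `L^q`. -/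
lemma lintegral_rpow_lintegral_one_div_max_le (h : NiceWeight ω)
    (hpos : ∀ r ∈ Ico (0:ℝ) 1, 0 < omegaHat ω r) {q : ℝ} (hq : 1 < q) :
    ∃ C > (0:ℝ), ∀ A : ℝ → ℝ≥0∞, Measurable A →
      ∫⁻ r, (∫⁻ s, A s * ENNReal.ofReal (1 / max (omegaHat ω r) (omegaHat ω s)) ∂radMeasure ω) ^ q
        ∂radMeasure ω ≤ ENNReal.ofReal C ^ q * ∫⁻ s, A s ^ q ∂radMeasure ω := by
  have hq0 : 0 < q := by linarith
  have hq1 : 1 / q < 1 := (div_lt_one hq0).2 hq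
  have hq1' : 0 < 1 / q := by positivity
  have hm := h.omegaHat_continuous.measurable
  have := h.radMeasure_finite
  set C : ℝ := 1 / (1 - 1 / q) + 1 / (1 / q) with hC
  have hC0 : 0 < C := by
    have : 0 < 1 - 1 / q := by linarith
    positivity
  refine ⟨C, hC0, fun A hA => ?_⟩
  have hωpos : ∀ᵐ s ∂radMeasure ω, 0 < omegaHat ω s := by
    filter_upwards [h.radMeasure_ae] with s hs using hpos s (Ioo_subset_Ico_self hs)
  have hwpow : ∀ s, 0 < omegaHat ω s → ENNReal.ofReal (omegaHat ω s ^ (-(1 / q))) ^ (q - 1) =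
      ENNReal.ofReal (omegaHat ω s ^ (-(1 - 1 / q))) := fun s hs => by
    rw [ENNReal.ofReal_rpow_of_pos (Real.rpow_pos_of_pos hs _), ← Real.rpow_mul hs.le]
    congr 2
    field_simp
  refine lintegral_rpow_lintegral_le_of_schur hq
    (w := fun s => ENNReal.ofReal (omegaHat ω s ^ (-(1 / q)))) hA (by fun_prop)
    (by unfold Function.uncurry; fun_prop) ?_ (Eventually.of_forall fun _ => ENNReal.ofReal_ne_top)
    ?_ ?_
  · filter_upwards [hωpos] with s hs
    simpa using Real.rpow_pos_of_pos hs _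
  · filter_upwards [hωpos] with r hr
    exact (lintegral_mono' h.radMeasure_le le_rfl).trans
      (h.lintegral_one_div_max_le hq1' hq1 hr)
  · filter_upwards [hωpos] with s hs
    rw [hwpow s hs]
    have h1 := h.lintegral_one_div_max_le (β := 1 - 1 / q) (by linarith) (by linarith) hs
    rw [sub_sub_cancel, add_comm, ← hC] at h1
    refine le_trans ?_ h1
    refine le_trans (lintegral_mono_ae ?_) (lintegral_mono' h.radMeasure_le le_rfl)
    filter_upwards [hωpos] with r hr
    rw [hwpow r hr, max_comm]

lemma MpEE_PomegaPlusL_le_max (h : NiceWeight ω) (hpos : ∀ r ∈ Ico (0:ℝ) 1, 0 < omegaHat ω r)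
    (hD : InDhat ω) {B : ℝ} (hB0 : 0 < B)
    (hB : ∀ ρ ∈ Ico (0:ℝ) 1, kerMean ω ρ ≤ B / omegaHat ω ρ) {p : ℝ} (hp : 1 < p) {f : ℂ → ℂ}
    (hf : Measurable f) (hA : ∀ᵐ s ∂radMeasure ω, circNorm p f s ≠ ⊤) {r : ℝ}
    (hr : r ∈ Ioo (0:ℝ) 1) :
    MpEE p r (PomegaPlusL ω f) ≤
      ENNReal.ofReal (1 / (2 * Real.pi)) ^ (1 / p) * ENNReal.ofReal (1 / Real.pi * B) *
        ∫⁻ s, circNorm p f s * ENNReal.ofReal (1 / max (omegaHat ω r) (omegaHat ω s))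
          ∂radMeasure ω := by
  have hπ := Real.pi_pos
  refine (h.MpEE_PomegaPlusL_le hpos hD hp hf hA hr).trans ?_
  rw [ENNReal.ofReal_mul (by positivity), mul_assoc, mul_assoc]
  refine mul_le_mul_right (mul_le_mul_right ?_ _) _
  rw [← lintegral_const_mul' _ _ ENNReal.ofReal_ne_top]
  refine lintegral_mono_ae ?_
  filter_upwards [h.radMeasure_ae] with s hs
  rw [mul_left_comm, ← ENNReal.ofReal_mul hB0.le]
  refine mul_le_mul_right (ENNReal.ofReal_le_ofReal ?_) _
  have hrs : r * s ∈ Ico (0:ℝ) 1 :=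
    ⟨mul_nonneg hr.1.le hs.1.le, by nlinarith [hr.1, hr.2, hs.1, hs.2]⟩
  refine (hB _ hrs).trans ?_
  rw [mul_one_div]
  refine div_le_div_of_nonneg_left hB0.le (lt_max_of_lt_left (hpos r (Ioo_subset_Ico_self hr)))
    (max_le ?_ ?_)
  · exact h.omegaHat_antitone (mul_le_of_le_one_right hr.1.le hs.2.le)
  · exact h.omegaHat_antitone (mul_le_of_le_one_left hs.1.le hr.2.le)

/-- Sufficiency: for weights in `D`, the maximal Bergman projection is bounded. -/
theorem exists_LpqNormEE_PomegaPlusL_le (h : NiceWeight ω)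
    (hpos : ∀ r ∈ Ico (0:ℝ) 1, 0 < omegaHat ω r)
    (hD : InDhat ω) (hDc : InDcheck ω) {p q : ℝ} (hp : 1 < p) (hq : 1 < q) :
    ∃ C > (0:ℝ), ∀ f : ℂ → ℂ,
      AEStronglyMeasurable f (volume.restrict (Metric.ball (0:ℂ) 1)) →
      LpqNormE ω p q f < ⊤ →
      LpqNormEE ω p q (PomegaPlusL ω f) ≤ ENNReal.ofReal C * LpqNormE ω p q f := by
  have hq0 : 0 < q := by linarith
  obtain ⟨B, hB0, hB⟩ := h.exists_kerMean_le hpos hD hDc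
  obtain ⟨C, hC0, hC⟩ := h.lintegral_rpow_lintegral_one_div_max_le hpos hq
  have hπ := Real.pi_pos
  refine ⟨1 / Real.pi * B * C, by positivity, fun f hf hfin => ?_⟩
  obtain ⟨g, hgm, hfg⟩ := hf
  have hg := hgm.measurable
  rw [LpqNormE_congr ω p q hfg] at hfin ⊢
  rw [PomegaPlusL_congr ω hfg]
  have hAm := measurable_circNorm p hg
  have hc0 : ENNReal.ofReal (1 / (2 * Real.pi)) ^ (1 / p) ≠ 0 :=
    (ENNReal.rpow_pos (ENNReal.ofReal_pos.2 (by positivity)) ENNReal.ofReal_ne_top).ne'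
  have hct : ENNReal.ofReal (1 / (2 * Real.pi)) ^ (1 / p) ≠ ⊤ :=
    ENNReal.rpow_ne_top_of_nonneg (by positivity) ENNReal.ofReal_ne_top
  rw [h.LpqNormE_eq hp hq hg] at hfin ⊢
  have hM := fun hA r (hr : r ∈ Ioo (0:ℝ) 1) =>
    h.MpEE_PomegaPlusL_le_max hpos hD hB0 hB hp hg hA hr
  have hC := hC _ hAm
  generalize circNorm p g = A at hfin hM hC hAm ⊢
  generalize ENNReal.ofReal (1 / (2 * Real.pi)) ^ (1 / p) = c at hc0 hct hfin hM ⊢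
  generalize (fun r => MpEE p r (PomegaPlusL ω g)) = M at hM ⊢
  have hAq : ∫⁻ s, A s ^ q ∂radMeasure ω ≠ ⊤ := by
    intro htop
    rw [htop, ENNReal.top_rpow_of_pos (by positivity), ENNReal.mul_top hc0] at hfin
    exact lt_irrefl _ hfin
  have hAfin : ∀ᵐ s ∂radMeasure ω, A s ≠ ⊤ := by
    filter_upwards [ae_lt_top (hAm.pow_const q) hAq] with s hs htop
    rw [htop, ENNReal.top_rpow_of_pos hq0] at hs
    exact lt_irrefl _ hs
  have hdt : c * ENNReal.ofReal (1 / Real.pi * B) ≠ ⊤ := ENNReal.mul_ne_top hct ENNReal.ofReal_ne_top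
  have key : ∀ a b x : ℝ≥0∞, (a ^ q * (b ^ q * x)) ^ (1 / q) = a * (b * x ^ (1 / q)) :=
    fun a b x => by
      rw [ENNReal.mul_rpow_of_nonneg _ _ (by positivity),
        ENNReal.mul_rpow_of_nonneg _ _ (by positivity), ← ENNReal.rpow_mul, ← ENNReal.rpow_mul,
        mul_one_div_cancel hq0.ne', ENNReal.rpow_one, ENNReal.rpow_one]
  rw [ENNReal.ofReal_mul (by positivity : 0 ≤ 1 / Real.pi * B)]
  refine le_of_le_of_eq ?_ ((key (c * ENNReal.ofReal (1 / Real.pi * B)) (ENNReal.ofReal C)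
    (∫⁻ s, A s ^ q ∂radMeasure ω)).trans (by ring))
  refine ENNReal.rpow_le_rpow (le_trans ?_ (mul_le_mul_right hC _)) (by positivity)
  rw [← lintegral_const_mul' _ _ (ENNReal.rpow_ne_top_of_nonneg hq0.le hdt), h.lintegral_radMeasure]
  refine setLIntegral_mono' measurableSet_Ioo fun r hr => ?_
  rw [mul_comm, ← ENNReal.mul_rpow_of_nonneg _ _ hq0.le]
  exact mul_le_mul_right (ENNReal.rpow_le_rpow (hM hAfin r hr) hq0.le) _

end NiceWeight

lemma half_mul_le_sum_Ico_one_div {N : ℕ} (hN : 0 < N) (L : ℕ) :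
    (L:ℝ) / 2 ≤ ∑ n ∈ Finset.Ico N (2 ^ L * N), 1 / ((n:ℝ) + 1) := by
  induction L with
  | zero => simp
  | succ L ih =>
    have h1 : N ≤ 2 ^ L * N := Nat.le_mul_of_pos_left _ (by positivity)
    have h2 : 2 ^ (L + 1) * N = 2 ^ L * N + 2 ^ L * N := by ring
    have hM : 0 < 2 ^ L * N := by positivity
    generalize 2 ^ L * N = M at ih h1 h2 hM
    rw [h2, ← Finset.sum_Ico_consecutive _ h1 (Nat.le_add_right M M)]
    have hM' : (0:ℝ) < M := by exact_mod_cast hM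
    have h3 : (1:ℝ) / 2 ≤ ∑ n ∈ Finset.Ico M (M + M), 1 / ((n:ℝ) + 1) := by
      calc (1:ℝ) / 2 = ∑ n ∈ Finset.Ico M (M + M), 1 / (2 * (M:ℝ)) := by
            rw [Finset.sum_const, Nat.card_Ico, Nat.add_sub_cancel, nsmul_eq_mul]
            field_simp
        _ ≤ _ := by
            refine Finset.sum_le_sum fun n hn => ?_
            rw [Finset.mem_Ico] at hn
            have : (n:ℝ) + 1 ≤ M + M := by exact_mod_cast hn.2
            exact one_div_le_one_div_of_le (by positivity) (by linarith)
    push_cast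
    linarith

/-- The characteristic function of the annulus `{a ≤ |ζ|}`. -/
def annulusInd (a : ℝ) : ℂ → ℂ := {ζ : ℂ | a ≤ ‖ζ‖}.indicator fun _ => 1

lemma measurable_annulusInd (a : ℝ) : Measurable (annulusInd a) :=
  measurable_const.indicator (measurableSet_le measurable_const measurable_norm)

lemma annulusInd_circlePt {a s : ℝ} (hs : 0 ≤ s) (φ : ℝ) :
    annulusInd a (circlePt s φ) = (Ici a).indicator (fun _ => 1) s := by
  simp only [annulusInd, indicator, mem_ofPred_eq, norm_circlePt hs, mem_Ici]

lemma le_MpEE_of_forall_le {p : ℝ} (hp : 1 < p) {r : ℝ} {c : ℝ≥0∞} {F : ℂ → ℝ≥0∞}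
    (hF : ∀ θ, c ≤ F (circlePt r θ)) : c ≤ MpEE p r F := by
  have hp0 : 0 < p := by linarith
  unfold MpEE
  calc c = (ENNReal.ofReal (1 / (2 * Real.pi)) *
        ∫⁻ _ in Ioo (0:ℝ) (2 * Real.pi), c ^ p) ^ (1 / p) := by
        rw [setLIntegral_const, Real.volume_Ioo, sub_zero, mul_left_comm,
          ← ENNReal.ofReal_mul (by positivity), one_div_mul_cancel Real.two_pi_pos.ne',
          ENNReal.ofReal_one, mul_one, ← ENNReal.rpow_mul, mul_one_div_cancel hp0.ne',
          ENNReal.rpow_one]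
    _ ≤ _ := by
        refine ENNReal.rpow_le_rpow (mul_le_mul_right ?_ _) (by positivity)
        exact lintegral_mono fun θ => ENNReal.rpow_le_rpow (hF θ) hp0.le

lemma MpE_annulusInd {p : ℝ} (hp : 1 < p) (a : ℝ) {s : ℝ} (hs : 0 ≤ s) :
    MpE p s (annulusInd a) = (Ici a).indicator (fun _ => 1) s := by
  have hp0 : 0 < p := by linarith
  unfold MpE
  simp_rw [annulusInd_circlePt hs]
  by_cases h : s ∈ Ici a
  · simp only [indicator_of_mem h, norm_one, Real.one_rpow, ENNReal.ofReal_one]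
    rw [setLIntegral_const, Real.volume_Ioo, sub_zero, one_mul,
      ← ENNReal.ofReal_mul (by positivity), one_div_mul_cancel Real.two_pi_pos.ne',
      ENNReal.ofReal_one, ENNReal.one_rpow]
  · simp [indicator_of_notMem h, Real.zero_rpow hp0.ne', hp0]

namespace NiceWeight

variable {ω : ℝ → ℝ}

lemma LpqNormE_annulusInd (h : NiceWeight ω) {p q : ℝ} (hp : 1 < p) (hq : 1 < q) (a : ℝ) :
    LpqNormE ω p q (annulusInd a) = radMeasure ω (Ici a) ^ (1 / q) := by
  have hq0 : 0 < q := by linarith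
  unfold LpqNormE
  congr 1
  rw [← lintegral_indicator_one measurableSet_Ici, h.lintegral_radMeasure]
  refine setLIntegral_congr_fun measurableSet_Ioo fun s hs => ?_
  rw [MpE_annulusInd hp a hs.1.le, mul_comm]
  by_cases hsa : s ∈ Ici a
  · simp [indicator_of_mem hsa]
  · simp [indicator_of_notMem hsa, hq0]

lemma mul_omegaHat_le_radMeasure_Ici (h : NiceWeight ω) {a : ℝ} (ha : 0 ≤ a) :
    ENNReal.ofReal (a * omegaHat ω a) ≤ radMeasure ω (Ici a) := by
  rw [ENNReal.ofReal_mul ha, ← h.weightMeasure_Ici, ← lintegral_indicator_one measurableSet_Ici,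
    ← lintegral_indicator_one measurableSet_Ici, h.lintegral_radMeasure, h.lintegral_weightMeasure,
    ← lintegral_const_mul' _ _ ENNReal.ofReal_ne_top]
  refine setLIntegral_mono' measurableSet_Ioo fun s hs => ?_
  by_cases hsa : s ∈ Ici a
  · simp only [indicator_of_mem hsa, Pi.one_apply, mul_one]
    rw [← ENNReal.ofReal_mul ha]
    exact ENNReal.ofReal_le_ofReal (mul_le_mul_of_nonneg_right hsa (h.nonneg s))
  · simp [indicator_of_notMem hsa]

lemma summable_kerCoeff_div (h : NiceWeight ω) (hpos : ∀ r ∈ Ico (0:ℝ) 1, 0 < omegaHat ω r)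
    (hD : InDhat ω) {ρ : ℝ} (hρ : ρ ∈ Ico (0:ℝ) 1) :
    Summable fun n : ℕ => kerCoeff ω n * ρ ^ n / (n + 1) := by
  have hnn : ∀ n : ℕ, 0 ≤ kerCoeff ω n * ρ ^ n := fun n =>
    mul_nonneg (h.kerCoeff_pos hpos n).le (pow_nonneg hρ.1 n)
  refine Summable.of_nonneg_of_le (fun n => div_nonneg (hnn n) (by positivity)) (fun n => ?_)
    (h.summable_kerCoeff hpos hD hρ)
  exact div_le_self (hnn n) (by linarith [Nat.cast_nonneg (α := ℝ) n])

lemma tsum_kerCoeff_le_kerMean_of_le (h : NiceWeight ω)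
    (hpos : ∀ r ∈ Ico (0:ℝ) 1, 0 < omegaHat ω r) (hD : InDhat ω) {x ρ : ℝ} (hx : 0 ≤ x)
    (hxρ : x ≤ ρ) (hρ : ρ < 1) :
    ∑' n : ℕ, kerCoeff ω n * x ^ n / (n + 1) ≤ kerMean ω ρ := by
  refine le_trans ?_ (h.tsum_kerCoeff_le_kerMean hpos hD ⟨hx.trans hxρ, hρ⟩)
  refine (h.summable_kerCoeff_div hpos hD ⟨hx, hxρ.trans_lt hρ⟩).tsum_le_tsum (fun n => ?_)
    (h.summable_kerCoeff_div hpos hD ⟨hx.trans hxρ, hρ⟩)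
  have := (h.kerCoeff_pos hpos n).le
  gcongr

lemma le_PomegaPlusL_annulusInd (h : NiceWeight ω) (hpos : ∀ r ∈ Ico (0:ℝ) 1, 0 < omegaHat ω r)
    (hD : InDhat ω) {a : ℝ} (ha : 0 < a) {r : ℝ} (har : a ≤ r) (hr : r < 1) (θ : ℝ) :
    ENNReal.ofReal (1 / Real.pi) *
      (ENNReal.ofReal (∑' n : ℕ, kerCoeff ω n * (a ^ 2) ^ n / (n + 1)) * radMeasure ω (Ici a)) ≤
      PomegaPlusL ω (annulusInd a) (circlePt r θ) := by
  have hr0 : 0 < r := ha.trans_le har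
  rw [h.PomegaPlusL_circlePt hpos hD (measurable_annulusInd a) ⟨hr0, hr⟩,
    ← lintegral_indicator_one measurableSet_Ici, ← lintegral_const_mul' _ _ ENNReal.ofReal_ne_top]
  refine mul_le_mul_right (lintegral_mono_ae ?_) _
  filter_upwards [h.radMeasure_ae] with s hs
  by_cases hsa : s ∈ Ici a
  · have hrs : r * s < 1 := by nlinarith [hs.1, hs.2]
    simp_rw [annulusInd_circlePt hs.1.le, indicator_of_mem hsa, norm_one, ENNReal.ofReal_one,
      one_mul]
    rw [(kerAbs_periodic ω (r * s)).setLIntegral_comp_sub Real.two_pi_pos,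
      h.lintegral_kerAbs hpos hD ⟨mul_nonneg hr0.le hs.1.le, hrs⟩, Pi.one_apply, mul_one]
    refine ENNReal.ofReal_le_ofReal
      (h.tsum_kerCoeff_le_kerMean_of_le hpos hD (sq_nonneg a) ?_ hrs)
    rw [sq]
    exact mul_le_mul har hsa ha.le hr0.le
  · simp [indicator_of_notMem hsa]

lemma tsum_mul_omegaHat_le (h : NiceWeight ω) (hpos : ∀ r ∈ Ico (0:ℝ) 1, 0 < omegaHat ω r)
    (hD : InDhat ω) {p q : ℝ} (hp : 1 < p) (hq : 1 < q) {C : ℝ} (hC0 : 0 < C)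
    (hC : ∀ f : ℂ → ℂ, AEStronglyMeasurable f (volume.restrict (Metric.ball (0:ℂ) 1)) →
      LpqNormE ω p q f < ⊤ →
      LpqNormEE ω p q (PomegaPlusL ω f) ≤ ENNReal.ofReal C * LpqNormE ω p q f)
    {a : ℝ} (ha : a ∈ Ioo (0:ℝ) 1) :
    (∑' n : ℕ, kerCoeff ω n * (a ^ 2) ^ n / (n + 1)) * (a * omegaHat ω a) ≤ Real.pi * C := by
  have hq0 : 0 < q := by linarith
  have hπ := Real.pi_pos
  have := h.radMeasure_finite
  set S := ∑' n : ℕ, kerCoeff ω n * (a ^ 2) ^ n / (n + 1) with hS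
  have hS0 : 0 ≤ S := tsum_nonneg fun n => by
    have := (h.kerCoeff_pos hpos n).le
    positivity
  have hVpos : 0 < a * omegaHat ω a := mul_pos ha.1 (hpos a (Ioo_subset_Ico_self ha))
  have hVge := h.mul_omegaHat_le_radMeasure_Ici ha.1.le
  have hV0 : radMeasure ω (Ici a) ≠ 0 :=
    ((ENNReal.ofReal_pos.2 hVpos).trans_le hVge).ne'
  have hVt : radMeasure ω (Ici a) ≠ ⊤ := measure_ne_top _ _
  have hlow : ∀ r, a ≤ r → r < 1 → _ ≤ MpEE p r (PomegaPlusL ω (annulusInd a)) :=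
    fun r har hr => le_MpEE_of_forall_le hp (h.le_PomegaPlusL_annulusInd hpos hD ha.1 har hr)
  have hfin := h.LpqNormE_annulusInd hp hq a
  have hCa := hC (annulusInd a) (measurable_annulusInd a).aestronglyMeasurable
    (by rw [hfin]; exact ENNReal.rpow_lt_top_of_nonneg (by positivity) hVt)
  rw [hfin] at hCa
  have hmain : ENNReal.ofReal (1 / Real.pi) * (ENNReal.ofReal S * radMeasure ω (Ici a)) *
      radMeasure ω (Ici a) ^ (1 / q) ≤ ENNReal.ofReal C * radMeasure ω (Ici a) ^ (1 / q) := by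
    refine le_trans ?_ hCa
    unfold LpqNormEE
    generalize ENNReal.ofReal (1 / Real.pi) * (ENNReal.ofReal S * radMeasure ω (Ici a)) = c at hlow
    calc c * radMeasure ω (Ici a) ^ (1 / q) = (c ^ q * radMeasure ω (Ici a)) ^ (1 / q) := by
          rw [ENNReal.mul_rpow_of_nonneg _ _ (by positivity), ← ENNReal.rpow_mul,
            mul_one_div_cancel hq0.ne', ENNReal.rpow_one]
      _ = (∫⁻ s in Ioo 0 1, ENNReal.ofReal (s * ω s) *
            (Ici a).indicator (fun _ => c ^ q) s) ^ (1 / q) := by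
          rw [← h.lintegral_radMeasure, lintegral_indicator_const measurableSet_Ici]
      _ ≤ _ := by
          refine ENNReal.rpow_le_rpow (setLIntegral_mono' measurableSet_Ioo fun s hs => ?_)
            (by positivity)
          by_cases hsa : s ∈ Ici a
          · rw [indicator_of_mem hsa, mul_comm]
            exact mul_le_mul_left (ENNReal.rpow_le_rpow (hlow s hsa hs.2) hq0.le) _
          · simp [indicator_of_notMem hsa]
  have h1 := (ENNReal.mul_le_mul_iff_left
    (ENNReal.rpow_pos (pos_iff_ne_zero.2 hV0) hVt).ne'
    (ENNReal.rpow_ne_top_of_nonneg (by positivity) hVt)).1 hmain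
  have h2 : ENNReal.ofReal (1 / Real.pi * (S * (a * omegaHat ω a))) ≤ ENNReal.ofReal C := by
    rw [ENNReal.ofReal_mul (by positivity), ENNReal.ofReal_mul hS0]
    exact (mul_le_mul_right (mul_le_mul_right hVge _) _).trans h1
  rw [ENNReal.ofReal_le_ofReal_iff hC0.le, one_div, inv_mul_le_iff₀ hπ] at h2
  exact h2

lemma le_tsum_kerCoeff (h : NiceWeight ω) (hpos : ∀ r ∈ Ico (0:ℝ) 1, 0 < omegaHat ω r)
    (hD : InDhat ω) : ∃ A > (0:ℝ), ∀ r ∈ Ico (0:ℝ) 1, ∀ L : ℕ, ∀ x ∈ Ico (0:ℝ) 1,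
      2 ^ L * (A / (1 - r)) * (1 - x) ≤ 1 / 2 →
      L / (16 * omegaHat ω r) ≤ ∑' n : ℕ, kerCoeff ω n * x ^ n / (n + 1) := by
  have hD' := hD
  obtain ⟨C, hC, hD⟩ := hD
  set A := max (Real.log (2 * C)) 1 with hA
  have hA1 : 1 ≤ A := le_max_right _ _
  have hCA : C * Real.exp (-A) ≤ 1 / 2 := by
    have : 2 * C ≤ Real.exp A :=
      (Real.log_le_iff_le_exp (by positivity)).1 (le_max_left _ _)
    rw [Real.exp_neg, ← div_eq_mul_inv, div_le_div_iff₀ (Real.exp_pos A) (by norm_num)]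
    linarith
  refine ⟨A + 1, by linarith, fun r hr L x hx hLx => ?_⟩
  have hr1 : 0 < 1 - r := by linarith [hr.2]
  have hωr := hpos r hr
  set N := ⌈A / (1 - r)⌉₊ with hN
  have hN0 : 0 < N := Nat.ceil_pos.2 (by positivity)
  have hN1 : (N:ℝ) ≤ (A + 1) / (1 - r) := by
    have h1 := (Nat.ceil_lt_add_one (by positivity : 0 ≤ A / (1 - r))).le
    have h2 : (1:ℝ) ≤ 1 / (1 - r) := by rw [le_div_iff₀ hr1]; linarith [hr.1]
    rw [add_div]
    linarith
  have hterm : ∀ n ∈ Finset.Ico N (2 ^ L * N),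
      1 / (8 * omegaHat ω r) * (1 / ((n:ℝ) + 1)) ≤ kerCoeff ω n * x ^ n / (n + 1) := by
    intro n hn
    rw [Finset.mem_Ico] at hn
    have hrn : C * r ^ n ≤ 1 / 2 := by
      refine le_trans (mul_le_mul_of_nonneg_left ?_ hC.le) hCA
      calc r ^ n ≤ Real.exp (-(1 - r)) ^ n := by
            refine pow_le_pow_left₀ hr.1 ?_ n
            linarith [Real.add_one_le_exp (-(1 - r))]
        _ = Real.exp (-((n:ℝ) * (1 - r))) := by rw [← Real.exp_nat_mul]; ring_nf
        _ ≤ Real.exp (-A) := by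
            refine Real.exp_le_exp.2 (neg_le_neg ?_)
            rw [← div_le_iff₀ hr1]
            exact (Nat.le_ceil _).trans (by exact_mod_cast hn.1)
    have hk : 1 / (4 * omegaHat ω r) ≤ kerCoeff ω n := by
      have h1 := h.natMoment_le_omegaHat hC hD n hr.1 hrn
      have h2 := h.natMoment_pos hpos (2 * n + 1)
      exact one_div_le_one_div_of_le (by positivity) (by linarith)
    have hxn : 1 / 2 ≤ x ^ n := by
      have h1 := one_add_mul_le_pow (by linarith [hx.1] : (-2:ℝ) ≤ x - 1) n
      rw [add_sub_cancel] at h1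
      have h2 : (n:ℝ) ≤ 2 ^ L * ((A + 1) / (1 - r)) := by
        calc (n:ℝ) ≤ 2 ^ L * N := by exact_mod_cast hn.2.le
          _ ≤ _ := by gcongr
      have h3 : (n:ℝ) * (1 - x) ≤ 1 / 2 :=
        (mul_le_mul_of_nonneg_right h2 (by linarith [hx.2])).trans hLx
      linarith
    have hk0 := (h.kerCoeff_pos hpos n).le
    calc 1 / (8 * omegaHat ω r) * (1 / ((n:ℝ) + 1))
        = 1 / (4 * omegaHat ω r) * (1 / 2) / (n + 1) := by field_simp; norm_num
      _ ≤ _ := by gcongr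
  calc L / (16 * omegaHat ω r) = 1 / (8 * omegaHat ω r) * (L / 2) := by field_simp; ring
    _ ≤ 1 / (8 * omegaHat ω r) * ∑ n ∈ Finset.Ico N (2 ^ L * N), 1 / ((n:ℝ) + 1) := by
        gcongr
        exact half_mul_le_sum_Ico_one_div hN0 L
    _ = ∑ n ∈ Finset.Ico N (2 ^ L * N), 1 / (8 * omegaHat ω r) * (1 / ((n:ℝ) + 1)) :=
        Finset.mul_sum _ _ _
    _ ≤ ∑ n ∈ Finset.Ico N (2 ^ L * N), kerCoeff ω n * x ^ n / (n + 1) :=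
        Finset.sum_le_sum hterm
    _ ≤ _ := (h.summable_kerCoeff_div hpos hD' hx).sum_le_tsum _ fun n _ => by
        have := (h.kerCoeff_pos hpos n).le
        have := hx.1
        positivity

/-- Necessity: if the maximal Bergman projection is bounded, then the weight is in `Ď`. -/
theorem inDcheck_of_LpqNormEE_PomegaPlusL_le (h : NiceWeight ω)
    (hpos : ∀ r ∈ Ico (0:ℝ) 1, 0 < omegaHat ω r)
    (hD : InDhat ω) {p q : ℝ} (hp : 1 < p) (hq : 1 < q)
    (hbdd : ∃ C > (0:ℝ), ∀ f : ℂ → ℂ,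
      AEStronglyMeasurable f (volume.restrict (Metric.ball (0:ℂ) 1)) →
      LpqNormE ω p q f < ⊤ →
      LpqNormEE ω p q (PomegaPlusL ω f) ≤ ENNReal.ofReal C * LpqNormE ω p q f) :
    InDcheck ω := by
  obtain ⟨C, hC0, hC⟩ := hbdd
  obtain ⟨A, hA0, hA⟩ := h.le_tsum_kerCoeff hpos hD
  have hπ := Real.pi_pos
  obtain ⟨L, hL⟩ := exists_nat_ge (64 * Real.pi * C)
  set K : ℝ := 2 ^ L * A * 4 + 2 with hK
  have hK2 : 2 ≤ K := le_add_of_nonneg_left (by positivity)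
  refine ⟨K, by linarith, 2, by norm_num, fun r hr => ?_⟩
  have hr1 : 0 < 1 - r := by linarith [hr.2]
  have hωr := hpos r hr
  set a := 1 - (1 - r) / K with ha
  have haK : (1 - a) * K = 1 - r := by rw [ha]; field_simp; ring
  have ha1 : a < 1 := sub_lt_self _ (by positivity)
  have ha2 : 1 / 2 ≤ a := by
    have : (1 - r) / K ≤ 1 / 2 := by
      rw [div_le_iff₀ (by linarith)]; linarith [hr.1]
    linarith
  have hωa := hpos a ⟨by linarith, ha1⟩
  have h1 := h.tsum_mul_omegaHat_le hpos hD hp hq hC0 hC (a := a) ⟨by linarith, ha1⟩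
  have h2 := hA r hr L (a ^ 2) ⟨sq_nonneg a, by nlinarith⟩ (by
    have : 1 - a ^ 2 ≤ 2 * (1 - a) := by nlinarith
    calc 2 ^ L * (A / (1 - r)) * (1 - a ^ 2) ≤ 2 ^ L * (A / (1 - r)) * (2 * (1 - a)) := by gcongr
      _ = 2 ^ L * A * 2 * (1 - a) / (1 - r) := by ring
      _ ≤ 1 / 2 := by
        rw [div_le_iff₀ hr1, ← haK, hK]
        nlinarith)
  have h3 : L / (16 * omegaHat ω r) * (1 / 2 * omegaHat ω a) ≤ Real.pi * C := by
    refine le_trans ?_ h1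
    have : (0:ℝ) ≤ L / (16 * omegaHat ω r) := by positivity
    exact mul_le_mul h2 (by gcongr) (by positivity) (this.trans h2)
  have h4 : (L:ℝ) * omegaHat ω a ≤ 32 * Real.pi * C * omegaHat ω r := by
    have e : L / (16 * omegaHat ω r) * (1 / 2 * omegaHat ω a) =
        L * omegaHat ω a / (32 * omegaHat ω r) := by field_simp; ring
    rw [e, div_le_iff₀ (by positivity)] at h3
    linarith
  have h5 : 64 * Real.pi * C * omegaHat ω a ≤ L * omegaHat ω a := by gcongr
  have h6 : 0 < Real.pi * C := by positivity
  nlinarith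

end NiceWeight

lemma IsRadialWeight.exists_niceWeight {ω : ℝ → ℝ} (hω : IsRadialWeight ω) :
    ∃ ω', NiceWeight ω' ∧ ∀ᵐ s ∂volume.restrict (Ioo (0:ℝ) 1), ω' s = ω s := by
  have hint : IntegrableOn ω (Ioo 0 1) := hω.2.mono_set Ioo_subset_Ico_self
  obtain ⟨ω₁, hm, hae⟩ := hint.1
  have hae' : ∀ᵐ s ∂volume.restrict (Ioo (0:ℝ) 1),
      (Ioo (0:ℝ) 1).indicator (fun s => max (ω₁ s) 0) s = ω s := by
    filter_upwards [hae, ae_restrict_mem measurableSet_Ioo] with s hs hmem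
    rw [indicator_of_mem hmem, ← hs, max_eq_left (hω.1 s (Ioo_subset_Ico_self hmem))]
  refine ⟨_, ⟨(hm.measurable.max measurable_const).indicator measurableSet_Ioo,
    fun s => indicator_nonneg (fun _ _ => le_max_right _ _) s,
    fun s hs => indicator_of_notMem hs _, ?_⟩, hae'⟩
  refine (integrable_indicator_iff measurableSet_Ioo).2 (hint.congr ?_)
  filter_upwards [hae', ae_restrict_mem measurableSet_Ioo] with s hs hmem
  rw [← hs, indicator_of_mem hmem]

section WeightCongr

variable {ω ω' : ℝ → ℝ}

lemma ae_uIoc_of_ae_Ioo (hae : ∀ᵐ s ∂volume.restrict (Ioo (0:ℝ) 1), ω' s = ω s) {r : ℝ}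
    (hr : r ∈ Ico (0:ℝ) 1) : ∀ᵐ s, s ∈ uIoc r 1 → ω' s = ω s := by
  rw [Measure.restrict_congr_set Ioo_ae_eq_Ioc, ae_restrict_iff' measurableSet_Ioc] at hae
  filter_upwards [hae] with s hs hsr
  rw [uIoc_of_le hr.2.le] at hsr
  exact hs ⟨hr.1.trans_lt hsr.1, hsr.2⟩

lemma omegaHat_congr (hae : ∀ᵐ s ∂volume.restrict (Ioo (0:ℝ) 1), ω' s = ω s) {r : ℝ}
    (hr : r ∈ Ico (0:ℝ) 1) : omegaHat ω' r = omegaHat ω r :=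
  intervalIntegral.integral_congr_ae (ae_uIoc_of_ae_Ioo hae hr)

lemma momentW_congr (hae : ∀ᵐ s ∂volume.restrict (Ioo (0:ℝ) 1), ω' s = ω s) :
    momentW ω' = momentW ω := by
  funext x
  refine intervalIntegral.integral_congr_ae ?_
  filter_upwards [ae_uIoc_of_ae_Ioo hae (left_mem_Ico.2 one_pos)] with s hs hmem
  rw [hs hmem]

lemma LpqNormE_weight_congr (hae : ∀ᵐ s ∂volume.restrict (Ioo (0:ℝ) 1), ω' s = ω s)
    (p q : ℝ) (f : ℂ → ℂ) : LpqNormE ω' p q f = LpqNormE ω p q f := by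
  unfold LpqNormE
  congr 1
  refine lintegral_congr_ae ?_
  filter_upwards [hae] with s hs
  rw [hs]

lemma LpqNormEE_weight_congr (hae : ∀ᵐ s ∂volume.restrict (Ioo (0:ℝ) 1), ω' s = ω s)
    (p q : ℝ) (F : ℂ → ℝ≥0∞) : LpqNormEE ω' p q F = LpqNormEE ω p q F := by
  unfold LpqNormEE
  congr 1
  refine lintegral_congr_ae ?_
  filter_upwards [hae] with s hs
  rw [hs]

lemma PomegaPlusL_weight_congr (hae : ∀ᵐ s ∂volume.restrict (Ioo (0:ℝ) 1), ω' s = ω s)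
    (f : ℂ → ℂ) : PomegaPlusL ω' f = PomegaPlusL ω f := by
  funext z
  refine lintegral_congr_ae ?_
  filter_upwards [ae_ball_norm_of_ae hae] with ζ hζ
  rw [hζ, bergmanKernel, bergmanKernel, momentW_congr hae]

lemma inDhat_congr (hae : ∀ᵐ s ∂volume.restrict (Ioo (0:ℝ) 1), ω' s = ω s) (hD : InDhat ω) :
    InDhat ω' := by
  obtain ⟨C, hC, h⟩ := hD
  refine ⟨C, hC, fun r hr => ?_⟩
  rw [omegaHat_congr hae hr, omegaHat_congr hae ⟨by linarith [hr.1], by linarith [hr.2]⟩]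
  exact h r hr

lemma inDcheck_congr (hae : ∀ᵐ s ∂volume.restrict (Ioo (0:ℝ) 1), ω' s = ω s) :
    InDcheck ω' ↔ InDcheck ω := by
  refine exists_congr fun K => and_congr_right fun hK => exists_congr fun C =>
    and_congr_right fun _ => forall₂_congr fun r hr => ?_
  have h1 : 0 < (1 - r) / K := div_pos (by linarith [hr.2]) (by linarith)
  have h2 : (1 - r) / K ≤ 1 - r := div_le_self (by linarith [hr.2]) hK.le
  rw [omegaHat_congr hae hr, omegaHat_congr hae ⟨by linarith [hr.1], by linarith⟩]

end WeightCongr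

/-- For `ω ∈ D̂` and `1<p,q<∞`, the maximal Bergman projection `P_ω⁺`
is bounded on `L^{p,q}_ω` if and only if `ω ∈ Ď`. -/
theorem maximal_bergman_projection_bounded_iff
    (ω : ℝ → ℝ) (hω : IsRadialWeight ω)
    (hpos : ∀ r ∈ Set.Ico (0:ℝ) 1, 0 < omegaHat ω r)
    (hD : InDhat ω)
    (p q : ℝ) (hp : 1 < p) (hq : 1 < q) :
    (∃ C > (0:ℝ), ∀ f : ℂ → ℂ,
      MeasureTheory.AEStronglyMeasurable f
        (MeasureTheory.volume.restrict (Metric.ball (0:ℂ) 1)) →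
      LpqNormE ω p q f < ⊤ →
      LpqNormEE ω p q (PomegaPlusL ω f) ≤ ENNReal.ofReal C * LpqNormE ω p q f)
    ↔ InDcheck ω := by
  obtain ⟨ω', h, hae⟩ := hω.exists_niceWeight
  have hpos' : ∀ r ∈ Ico (0:ℝ) 1, 0 < omegaHat ω' r := fun r hr =>
    (hpos r hr).trans_eq (omegaHat_congr hae hr).symm
  have hD' := inDhat_congr hae hD
  simp_rw [← LpqNormE_weight_congr hae, ← LpqNormEE_weight_congr hae,
    ← PomegaPlusL_weight_congr hae]
  rw [← inDcheck_congr hae]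
  exact ⟨h.inDcheck_of_LpqNormEE_PomegaPlusL_le hpos' hD' hp hq,
    fun hDc => h.exists_LpqNormEE_PomegaPlusL_le hpos' hD' hDc hp hq⟩
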